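/- Let K be a valued field whose value group has a least positive element, regarded as an L_VR-structure, elementarily equivalent to ℂ((t)), with residue field k, and let L be an elementary L_VR-extension of K, with valuation ring O_L, residue field k_L ⊇ k and residue map res : O_L → k_L. Let n ≥ 1 and let g, h ∈ O_L^{n×n} be matrices such that the n² entries of res(g) are algebraically independent over k, and likewise the n² entries of res(h) are algebraically independent over k. Then g ∈ GL(n, O_L), h ∈ GL(n, O_L), and g and h realize the same complete type over K: for every L_VR-formula φ(x̄) in n² free variables with parameters from K, L ⊨ φ(g) if and only if L ⊨ φ(h). -/

import Mathlib

open FirstOrder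

/-- The function symbols of the language `L_VR`: the ring language `{0, 1, +, ×}`. -/
inductive LVRFunc : ℕ → Type
  | zero : LVRFunc 0
  | one : LVRFunc 0
  | add : LVRFunc 2
  | mul : LVRFunc 2

/-- The relation symbols of the language `L_VR`: a binary divisibility relation `|`,
a unary relation `N`, and a unary relation `P_n` for each `n ≥ 1`. -/
inductive LVRRel : ℕ → Type
  | dvd : LVRRel 2
  | N : LVRRel 1
  | pow : ℕ+ → LVRRel 1

/-- The first-order language `L_VR` of valuation rings. -/
def LVR : FirstOrder.Language where
  Functions := LVRFunc
  Relations := LVRRel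

/-- Interpretation of the `L_VR` function symbols in a field. -/
def LVRfun (K : Type*) [Field K] : ∀ {n : ℕ}, LVRFunc n → (Fin n → K) → K
  | _, .zero => fun _ => 0
  | _, .one => fun _ => 1
  | _, .add => fun x => x 0 + x 1
  | _, .mul => fun x => x 0 * x 1

/-- Interpretation of the `L_VR` relation symbols in a valued field (Mathlib's
multiplicative convention for valuations is order-reversing w.r.t. the additive
convention of the paper: `x | y` means `v_add(x) ≤ v_add(y)`, i.e. multiplicatively
`v (x 1) ≤ v (x 0)`; `N x` means `v_add(x) = 1_Γ`, where `γ₁` is the multiplicative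
avatar of the least positive element of the value group; `P_n x` means `x` is an
`n`-th power). -/
def LVRrel {K : Type*} [Field K] {Γ₀ : Type*} [LinearOrderedCommGroupWithZero Γ₀]
    (v : Valuation K Γ₀) (γ₁ : Γ₀) : ∀ {n : ℕ}, LVRRel n → (Fin n → K) → Prop
  | _, .dvd => fun x => v (x 1) ≤ v (x 0)
  | _, .N => fun x => v (x 0) = γ₁
  | _, .pow m => fun x => ∃ y : K, x 0 = y ^ (m : ℕ)

/-- A valued field, together with the (multiplicative avatar of the) least positive
element of its value group, as an `L_VR`-structure. -/
def valuedStructure {K : Type*} [Field K] {Γ₀ : Type*} [LinearOrderedCommGroupWithZero Γ₀]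
    (v : Valuation K Γ₀) (γ₁ : Γ₀) : LVR.Structure K where
  funMap := LVRfun K
  RelMap := LVRrel v γ₁

/-- `γ₁` is the multiplicative avatar of the least positive element of the value
group: the greatest element of `Γ₀ ∖ {0}` that is `< 1`. -/
def IsLeastPos {Γ₀ : Type*} [LinearOrderedCommGroupWithZero Γ₀] (γ₁ : Γ₀) : Prop :=
  γ₁ ≠ 0 ∧ γ₁ < 1 ∧ ∀ δ : Γ₀, δ ≠ 0 → δ < 1 → δ ≤ γ₁

/-- `ℂ((t))`, the field of formal Laurent series over `ℂ` with its `t`-adic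
valuation, as an `L_VR`-structure. -/
noncomputable def laurentStructure : LVR.Structure (LaurentSeries ℂ) :=
  valuedStructure (Valued.v : Valuation (LaurentSeries ℂ) (WithZero (Multiplicative ℤ)))
    ((Multiplicative.ofAdd (-1 : ℤ) : Multiplicative ℤ) : WithZero (Multiplicative ℤ))

universe u

open Polynomial in
/-- A valued field whose value group has least positive element `v π`, with the algebraic properties
of `ℂ((t))`: henselian, with algebraically closed residue field of characteristic zero, and
with value group a `ℤ`-group. -/
structure IsLaurentLike {F Γ : Type*} [Field F] [LinearOrderedCommGroupWithZero Γ]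
    (v : Valuation F Γ) (π : F) : Prop where
  unif_ne : π ≠ 0
  unif_lt : v π < 1
  unif_le : ∀ x, v x < 1 → v x ≤ v π
  natCast : ∀ n : ℕ, n ≠ 0 → v (n : F) = 1
  hensel : ∀ p : F[X], (∀ k, v (p.coeff k) ≤ 1) → v (p.coeff 0) < 1 → v (p.coeff 1) = 1 →
    ∃ y, v y < 1 ∧ p.eval y = 0
  residue : ∀ p : F[X], p.Monic → p.natDegree ≠ 0 → (∀ k, v (p.coeff k) ≤ 1) →
    ∃ x, v x ≤ 1 ∧ v (p.eval x) < 1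
  div : ∀ n : ℕ, n ≠ 0 → ∀ x, ∃ y, ∃ k < n, v x = v y ^ n * v π ^ k

/-- Two ring homomorphisms into valued fields whose images correspond under a partial isomorphism
for the language `L_VR`. -/
structure PartialIso {F Γ G Δ A : Type*} [Field F] [LinearOrderedCommGroupWithZero Γ]
    [Field G] [LinearOrderedCommGroupWithZero Δ] [CommRing A]
    (v : Valuation F Γ) (π : F) (w : Valuation G Δ) (ϖ : G) (i : A →+* F) (j : A →+* G) :
    Prop where
  le_iff : ∀ a b, v (i a) ≤ v (i b) ↔ w (j a) ≤ w (j b)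
  pow_iff : ∀ a (n : ℕ), n ≠ 0 → ((∃ y, v (i a) = v y ^ n) ↔ ∃ y, w (j a) = w y ^ n)
  unif : ∃ a, i a = π ∧ j a = ϖ

lemma Valuation.exists_eq_pow_iff_mul_pow {F Γ : Type*} [Field F]
    [LinearOrderedCommGroupWithZero Γ] (v : Valuation F Γ) (x : F) {z : F} (hz : v z ≠ 0)
    (N : ℕ) {n : ℕ} : (∃ y, v x = v y ^ n) ↔ ∃ y, v x * v z ^ (N * n) = v y ^ n := by
  constructor
  · rintro ⟨y, hy⟩
    exact ⟨y * z ^ N, by rw [hy]; simp [mul_pow, pow_mul]⟩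
  · rintro ⟨y, hy⟩
    refine ⟨y / z ^ N, ?_⟩
    simp only [map_div₀, map_pow, div_pow, ← hy, ← pow_mul]
    field_simp

section Basic

open Polynomial

variable {F Γ G Δ A : Type*} [Field F] [LinearOrderedCommGroupWithZero Γ]
    [Field G] [LinearOrderedCommGroupWithZero Δ]
    {v : Valuation F Γ} {π : F} {w : Valuation G Δ} {ϖ : G}

namespace PartialIso

section

variable [CommRing A] {i : A →+* F} {j : A →+* G}

lemma symm (h : PartialIso v π w ϖ i j) : PartialIso w ϖ v π j i where
  le_iff a b := (h.le_iff a b).symm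
  pow_iff a n hn := (h.pow_iff a n hn).symm
  unif := let ⟨a, h1, h2⟩ := h.unif; ⟨a, h2, h1⟩

lemma lt_iff (h : PartialIso v π w ϖ i j) (a b : A) :
    v (i a) < v (i b) ↔ w (j a) < w (j b) := by
  simpa using (h.le_iff b a).not

lemma eq_iff (h : PartialIso v π w ϖ i j) (a b : A) :
    v (i a) = v (i b) ↔ w (j a) = w (j b) := by
  simp only [le_antisymm_iff, h.le_iff]

lemma le_one_iff (h : PartialIso v π w ϖ i j) (a : A) : v (i a) ≤ 1 ↔ w (j a) ≤ 1 := by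
  simpa using h.le_iff a 1

lemma lt_one_iff (h : PartialIso v π w ϖ i j) (a : A) : v (i a) < 1 ↔ w (j a) < 1 := by
  simpa using h.lt_iff a 1

lemma eq_zero_iff (h : PartialIso v π w ϖ i j) (a : A) : i a = 0 ↔ j a = 0 := by
  simpa using h.eq_iff a 0

lemma adjoin (h : PartialIso v π w ϖ i j) {b : F} {c : G}
    (hterm : ∀ p : A[X], ∃ r, ∃ k : ℕ,
      v (p.eval₂ i b) = v (i r * b ^ k) ∧ w (p.eval₂ j c) = w (j r * c ^ k))
    (hle : ∀ r s (k l : ℕ), v (i r * b ^ k) ≤ v (i s * b ^ l) ↔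
      w (j r * c ^ k) ≤ w (j s * c ^ l))
    (hpow : ∀ r (k n : ℕ), n ≠ 0 → ((∃ y, v (i r * b ^ k) = v y ^ n) ↔
      ∃ y, w (j r * c ^ k) = w y ^ n)) :
    PartialIso v π w ϖ (eval₂RingHom i b) (eval₂RingHom j c) where
  le_iff p q := by
    obtain ⟨r, k, h1, h2⟩ := hterm p
    obtain ⟨s, l, h3, h4⟩ := hterm q
    simp only [coe_eval₂RingHom, h1, h2, h3, h4, hle]
  pow_iff p n hn := by
    obtain ⟨r, k, h1, h2⟩ := hterm p
    simp only [coe_eval₂RingHom, h1, h2, hpow r k n hn]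
  unif := by
    obtain ⟨a, h1, h2⟩ := h.unif
    exact ⟨C a, by simpa using h1, by simpa using h2⟩

lemma adjoin_immediate (h : PartialIso v π w ϖ i j) {b : F} {c : G}
    (hterm : ∀ p : A[X], ∃ r, v (p.eval₂ i b) = v (i r) ∧ w (p.eval₂ j c) = w (j r)) :
    PartialIso v π w ϖ (eval₂RingHom i b) (eval₂RingHom j c) where
  le_iff p q := by
    obtain ⟨r, h1, h2⟩ := hterm p
    obtain ⟨s, h3, h4⟩ := hterm q
    simp only [coe_eval₂RingHom, h1, h2, h3, h4, h.le_iff]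
  pow_iff p n hn := by
    obtain ⟨r, h1, h2⟩ := hterm p
    simp only [coe_eval₂RingHom, h1, h2, h.pow_iff r n hn]
  unif := by
    obtain ⟨a, h1, h2⟩ := h.unif
    exact ⟨C a, by simpa using h1, by simpa using h2⟩

lemma adjoin_inv (h : PartialIso v π w ϖ i j) {r : A} (hr : i r ≠ 0) :
    PartialIso v π w ϖ (eval₂RingHom i (i r)⁻¹) (eval₂RingHom j (j r)⁻¹) := by
  have hr' : j r ≠ 0 := fun h0 => hr ((h.eq_zero_iff r).2 h0)
  have key : ∀ p : A[X], ∃ (N : ℕ) (s : A), i s = p.eval₂ i (i r)⁻¹ * i r ^ N ∧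
      j s = p.eval₂ j (j r)⁻¹ * j r ^ N := by
    intro p
    induction p using Polynomial.induction_on' with
    | add p q hp hq =>
      obtain ⟨N, s, h1, h2⟩ := hp
      obtain ⟨M, t, h3, h4⟩ := hq
      refine ⟨N + M, s * r ^ M + t * r ^ N, ?_, ?_⟩
      · simp only [map_add, map_mul, map_pow, eval₂_add, h1, h3]; ring
      · simp only [map_add, map_mul, map_pow, eval₂_add, h2, h4]; ring
    | monomial n a => exact ⟨n, a, by simp [eval₂_monomial, hr], by simp [eval₂_monomial, hr']⟩
  have hv : v (i r) ≠ 0 := by simpa using hr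
  have hw : w (j r) ≠ 0 := by simpa using hr'
  refine ⟨fun p q => ?_, fun p n hn => ?_, ?_⟩
  · obtain ⟨N, s, h1, h2⟩ := key p
    obtain ⟨M, t, h3, h4⟩ := key q
    have := h.le_iff (s * r ^ M) (t * r ^ N)
    simp only [map_mul, map_pow, h1, h2, h3, h4] at this
    rw [mul_assoc, mul_assoc, mul_assoc, mul_assoc, ← pow_add, ← pow_add, ← pow_add, ← pow_add,
      add_comm M N, mul_le_mul_iff_left₀ (pow_pos (zero_lt_iff.2 hv) _),
      mul_le_mul_iff_left₀ (pow_pos (zero_lt_iff.2 hw) _)] at this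
    exact this
  · obtain ⟨N, s, h1, h2⟩ := key p
    have := h.pow_iff (s * r ^ (N * (n - 1))) n hn
    have e : N + N * (n - 1) = N * n := by
      obtain ⟨m, rfl⟩ := Nat.exists_eq_succ_of_ne_zero hn
      simp; ring
    simp only [map_mul, map_pow, h1, h2] at this
    rw [mul_assoc, mul_assoc, ← pow_add, ← pow_add, e] at this
    simp only [coe_eval₂RingHom]
    rw [Valuation.exists_eq_pow_iff_mul_pow v _ hv N, Valuation.exists_eq_pow_iff_mul_pow w _ hw N]
    exact this
  · obtain ⟨a, h1, h2⟩ := h.unif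
    exact ⟨C a, by simpa using h1, by simpa using h2⟩

lemma range {B : Type*} [CommRing B] {i : B →+* F} {j : B →+* G}
    (h : PartialIso v π w ϖ i j) :
    PartialIso v π w ϖ ((RingHom.fst F G).comp (i.prod j).range.subtype)
      ((RingHom.snd F G).comp (i.prod j).range.subtype) := by
  refine ⟨?_, ?_, ?_⟩
  · rintro ⟨_, a, rfl⟩ ⟨_, b, rfl⟩
    exact h.le_iff a b
  · rintro ⟨_, a, rfl⟩ n hn
    exact h.pow_iff a n hn
  · obtain ⟨a, h1, h2⟩ := h.unif
    exact ⟨⟨_, a, rfl⟩, h1, h2⟩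

end

/-- A partial isomorphism defined on a field that cannot be extended by a single pair. -/
structure IsMaximal [Field A] (v : Valuation F Γ) (π : F) (w : Valuation G Δ) (ϖ : G)
    (i : A →+* F) (j : A →+* G) : Prop extends PartialIso v π w ϖ i j where
  max : ∀ b c, PartialIso v π w ϖ (eval₂RingHom i b) (eval₂RingHom j c) → ∃ a, i a = b ∧ j a = c

end PartialIso

end Basic

lemma PartialIso.exists_isMaximal {F Γ G Δ A : Type u} [Field F] [LinearOrderedCommGroupWithZero Γ]
    [Field G] [LinearOrderedCommGroupWithZero Δ] [CommRing A]
    {v : Valuation F Γ} {π : F} {w : Valuation G Δ} {ϖ : G} {i : A →+* F} {j : A →+* G}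
    (h : PartialIso v π w ϖ i j) :
    ∃ (B : Type u) (_ : Field B) (κ : A →+* B) (i' : B →+* F) (j' : B →+* G),
      i'.comp κ = i ∧ j'.comp κ = j ∧ PartialIso.IsMaximal v π w ϖ i' j' := by
  let P : Subring (F × G) → Prop := fun R =>
    PartialIso v π w ϖ ((RingHom.fst F G).comp R.subtype) ((RingHom.snd F G).comp R.subtype)
  obtain ⟨R, hR, hmax⟩ := zorn_le_nonempty₀ {R | P R} (by
    intro c hc hchain y hy
    have hdir : DirectedOn (· ≤ ·) c := hchain.directedOn
    refine ⟨sSup c, ?_, fun z hz => le_sSup hz⟩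
    have mem : ∀ x, x ∈ sSup c ↔ ∃ R ∈ c, x ∈ R := fun x =>
      Subring.mem_sSup_of_directedOn ⟨y, hy⟩ hdir
    refine ⟨?_, ?_, ?_⟩
    · rintro ⟨a, ha⟩ ⟨b, hb⟩
      obtain ⟨R, hR, ha⟩ := (mem a).1 ha
      obtain ⟨S, hS, hb⟩ := (mem b).1 hb
      obtain ⟨T, hT, hRT, hST⟩ := hdir R hR S hS
      exact (hc hT).le_iff ⟨a, hRT ha⟩ ⟨b, hST hb⟩
    · rintro ⟨a, ha⟩ n hn
      obtain ⟨R, hR, ha⟩ := (mem a).1 ha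
      exact (hc hR).pow_iff ⟨a, ha⟩ n hn
    · obtain ⟨⟨a, ha⟩, h1, h2⟩ := (hc hy).unif
      exact ⟨⟨a, (mem a).2 ⟨y, hy, ha⟩⟩, h1, h2⟩) (i.prod j).range h.range
  have ext : ∀ b c, PartialIso v π w ϖ
      (Polynomial.eval₂RingHom ((RingHom.fst F G).comp R.subtype) b)
      (Polynomial.eval₂RingHom ((RingHom.snd F G).comp R.subtype) c) → (b, c) ∈ R := by
    intro b c hbc
    refine hmax.2 hbc.range (fun x hx => ?_) ?_
    · exact ⟨Polynomial.C ⟨x, hx⟩, by simp⟩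
    · exact ⟨Polynomial.X, by simp⟩
  have hP : P R := hmax.1
  have hfield : IsField R := by
    refine ⟨⟨0, 1, ?_⟩, mul_comm, fun {a} ha => ?_⟩
    · intro h01
      have := congrArg (fun x : R => x.1.1) h01
      simp at this
    · have ha1 : (RingHom.fst F G).comp R.subtype a ≠ 0 := by
        intro h0
        have h2 := (hP.eq_zero_iff a).1 h0
        exact ha (Subtype.ext (Prod.ext h0 h2))
      have ha2 : (RingHom.snd F G).comp R.subtype a ≠ 0 :=
        fun h0 => ha1 ((hP.eq_zero_iff a).2 h0)
      refine ⟨⟨_, ext _ _ (hP.adjoin_inv ha1)⟩, Subtype.ext (Prod.ext ?_ ?_)⟩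
      · exact mul_inv_cancel₀ ha1
      · exact mul_inv_cancel₀ ha2
  let κ : A →+* R := (i.prod j).codRestrict R fun a => hR ⟨a, rfl⟩
  exact ⟨R, hfield.toField, κ, (RingHom.fst F G).comp R.subtype, (RingHom.snd F G).comp R.subtype,
    rfl, rfl, @PartialIso.IsMaximal.mk F Γ G Δ R _ _ _ _ hfield.toField v π w ϖ _ _ hP
      fun b c hbc => ⟨⟨(b, c), ext b c hbc⟩, rfl, rfl⟩⟩

section Model

open Polynomial

variable {F Γ : Type*} [Field F] [LinearOrderedCommGroupWithZero Γ] {v : Valuation F Γ}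

namespace Valuation

lemma natCast_le_one (v : Valuation F Γ) (n : ℕ) : v (n : F) ≤ 1 :=
  natCast_mem v.valuationSubring n

lemma eval_le_one {p : F[X]} (hp : ∀ k, v (p.coeff k) ≤ 1) {x : F} (hx : v x ≤ 1) :
    v (p.eval x) ≤ 1 := by
  rw [eval_eq_sum_range]
  refine v.map_sum_le fun k _ => ?_
  rw [map_mul, map_pow]
  exact mul_le_one' (hp k) (pow_le_one' hx k)

lemma hasseDeriv_coeff_le_one {p : F[X]} (hp : ∀ k, v (p.coeff k) ≤ 1) (m k : ℕ) :
    v ((hasseDeriv m p).coeff k) ≤ 1 := by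
  rw [hasseDeriv_coeff, map_mul]
  exact mul_le_one' (v.natCast_le_one _) (hp _)

lemma taylor_coeff_le_one {p : F[X]} (hp : ∀ k, v (p.coeff k) ≤ 1) {x : F} (hx : v x ≤ 1)
    (k : ℕ) : v ((taylor x p).coeff k) ≤ 1 := by
  rw [taylor_coeff]
  exact eval_le_one (hasseDeriv_coeff_le_one hp k) hx

lemma eval_sub_coeff_zero_le {p : F[X]} (hp : ∀ k, v (p.coeff k) ≤ 1) {x : F} (hx : v x ≤ 1) :
    v (p.eval x - p.coeff 0) ≤ v x := by
  have h : p.eval x - p.coeff 0 = p.divX.eval x * x := by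
    conv_lhs => rw [← divX_mul_X_add p]
    simp
  rw [h, map_mul]
  refine mul_le_of_le_one_left' (eval_le_one (fun k => ?_) hx)
  rw [coeff_divX]
  exact hp _

lemma eval_sub_eval_le {p : F[X]} (hp : ∀ k, v (p.coeff k) ≤ 1) {x y : F} (hx : v x ≤ 1)
    (hxy : v (y - x) ≤ 1) : v (p.eval y - p.eval x) ≤ v (y - x) := by
  simpa [taylor_eval] using eval_sub_coeff_zero_le (taylor_coeff_le_one hp hx) hxy

end Valuation

open Valuation

namespace IsLaurentLike

variable {π : F} (hv : IsLaurentLike v π)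

include hv

lemma unif_pos : 0 < v π := by
  have := hv.unif_ne
  simpa [zero_lt_iff] using this

lemma le_mul_unif {x y : F} (h : v x < v y) : v x ≤ v y * v π := by
  have hy : v y ≠ 0 := (zero_le.trans_lt h).ne'
  have := hv.unif_le (x / y) (by rw [map_div₀]; exact (div_lt_one₀ (zero_lt_iff.2 hy)).2 h)
  rw [map_div₀, div_le_iff₀ (zero_lt_iff.2 hy)] at this
  rwa [mul_comm]

lemma exists_root {p : F[X]} (hp : ∀ k, v (p.coeff k) ≤ 1) {x : F} (hx : v x ≤ 1)
    (h0 : v (p.eval x) < 1) (h1 : v (p.derivative.eval x) = 1) :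
    ∃ y, v (y - x) < 1 ∧ p.eval y = 0 := by
  obtain ⟨z, hz, hz0⟩ := hv.hensel (taylor x p) (taylor_coeff_le_one hp hx)
    (by rwa [taylor_coeff_zero]) (by rwa [taylor_coeff_one])
  exact ⟨z + x, by simpa using hz, by rwa [taylor_eval] at hz0⟩

lemma exists_pow_eq_iff {n : ℕ} (hn : n ≠ 0) (x : F) :
    (∃ z, x = z ^ n) ↔ ∃ y, v x = v y ^ n := by
  refine ⟨fun ⟨z, hz⟩ => ⟨z, by rw [hz, map_pow]⟩, fun ⟨y, hy⟩ => ?_⟩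
  rcases eq_or_ne y 0 with rfl | hy0
  · exact ⟨0, by simpa [hn] using hy⟩
  have hvy : v y ≠ 0 := by simpa using hy0
  set u := x / y ^ n with hu
  have hvu : v u = 1 := by rw [hu, map_div₀, map_pow, hy, div_self (pow_ne_zero _ hvy)]
  have hcoeff : ∀ k, v ((X ^ n - C u : F[X]).coeff k) ≤ 1 := by
    intro k
    rw [coeff_sub, coeff_X_pow, coeff_C]
    refine v.map_sub_le ?_ ?_ <;> split_ifs <;> simp [hvu]
  obtain ⟨t, ht, ht0⟩ := hv.residue _ (monic_X_pow_sub_C u hn) (by rwa [natDegree_X_pow_sub_C])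
    hcoeff
  have hvt : v t = 1 := by
    have : v (t ^ n) = 1 := by
      rw [← hvu]
      refine v.map_eq_of_sub_lt ?_
      rw [hvu, ← map_sub_swap]
      simpa [map_sub_swap] using ht0
    rw [map_pow] at this
    exact (pow_eq_one_iff_of_nonneg zero_le hn).1 this
  obtain ⟨s, -, hs⟩ := hv.exists_root hcoeff ht ht0 (by
    simp [derivative_X_pow, hvt, hv.natCast n hn])
  refine ⟨s * y, ?_⟩
  have hs' : s ^ n = u := by simpa [sub_eq_zero] using hs
  rw [mul_pow, hs', hu, div_mul_cancel₀ _ (pow_ne_zero _ hy0)]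

end IsLaurentLike

end Model

section Purity

open Polynomial

variable {F Γ G Δ A : Type*} [Field F] [LinearOrderedCommGroupWithZero Γ]
    [Field G] [LinearOrderedCommGroupWithZero Δ]
    {v : Valuation F Γ} {π : F} {w : Valuation G Δ} {ϖ : G}

lemma Valuation.eval₂_eq_of_dominant [CommRing A] {i : A →+* F} {b : F} {p : A[X]} {k : ℕ}
    (h : ∀ l, l ≠ k → v (i (p.coeff l) * b ^ l) < v (i (p.coeff k) * b ^ k)) :
    v (p.eval₂ i b) = v (i (p.coeff k) * b ^ k) := by
  rw [eval₂_eq_sum_range]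
  refine v.map_sum_eq_of_lt (j := k) ?_ (fun l hl => h l (by simpa using (Finset.mem_sdiff.1 hl).2))
  simp only [Finset.mem_range]
  by_contra hk
  have := h (k + 1) (by simp)
  rw [coeff_eq_zero_of_natDegree_lt (n := k) (by lia)] at this
  simp at this

lemma Valuation.exists_eq_pow_iff_pow {x : F} {m n : ℕ} (hn : n ≠ 0) :
    (∃ y, v x = v y ^ m) ↔ ∃ y, v (x ^ n) = v y ^ (m * n) := by
  refine exists_congr fun y => ?_
  rw [map_pow, pow_mul, pow_left_inj₀ zero_le zero_le hn]

namespace PartialIso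

lemma adjoin_radical [CommRing A] {i : A →+* F} {j : A →+* G} (h : PartialIso v π w ϖ i j)
    {n : ℕ} (hn : n ≠ 0) {r : A} {b : F} {c : G} (hb : b ^ n = i r) (hc : c ^ n = j r)
    (hdist : ∀ s t k l, k < l → l < n → v (i s * b ^ k) = v (i t * b ^ l) → t = 0) :
    PartialIso v π w ϖ (eval₂RingHom i b) (eval₂RingHom j c) := by
  have hb' : ∀ a k, (i a * b ^ k) ^ n = i (a ^ n * r ^ k) := by
    intro a k
    rw [mul_pow, ← pow_mul, mul_comm k, pow_mul, hb, map_mul, map_pow, map_pow]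
  have hc' : ∀ a k, (j a * c ^ k) ^ n = j (a ^ n * r ^ k) := by
    intro a k
    rw [mul_pow, ← pow_mul, mul_comm k, pow_mul, hc, map_mul, map_pow, map_pow]
  have hle : ∀ s t (k l : ℕ), v (i s * b ^ k) ≤ v (i t * b ^ l) ↔
      w (j s * c ^ k) ≤ w (j t * c ^ l) := by
    intro s t k l
    rw [← pow_le_pow_iff_left₀ zero_le zero_le hn, ← map_pow, ← map_pow, hb', hb', h.le_iff,
      ← hc', ← hc', map_pow, map_pow, pow_le_pow_iff_left₀ zero_le zero_le hn]
  have hlt : ∀ s t (k l : ℕ), v (i s * b ^ k) < v (i t * b ^ l) ↔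
      w (j s * c ^ k) < w (j t * c ^ l) := by
    intro s t k l
    simpa using (hle t s l k).not
  refine h.adjoin (fun p => ?_) hle (fun a k m hm => ?_)
  · have := i.domain_nontrivial
    set q := p %ₘ (X ^ n - C r) with hq
    have hmonic : (X ^ n - C r).Monic := monic_X_pow_sub_C r hn
    have hdeg : q.natDegree < n := by
      have := natDegree_modByMonic_lt p hmonic (by
        intro h1
        have := congrArg natDegree h1
        rw [natDegree_X_pow_sub_C] at this
        simp at this
        exact hn this)
      rwa [natDegree_X_pow_sub_C] at this
    have hqF : q.eval₂ i b = p.eval₂ i b := by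
      conv_rhs => rw [← modByMonic_add_div p (X ^ n - C r)]
      simp [hq, hb]
    have hqG : q.eval₂ j c = p.eval₂ j c := by
      conv_rhs => rw [← modByMonic_add_div p (X ^ n - C r)]
      simp [hq, hc]
    obtain ⟨k, hk, hmax⟩ := Finset.exists_max_image (Finset.range n)
      (fun k => v (i (q.coeff k) * b ^ k)) ⟨0, by simpa using Nat.pos_of_ne_zero hn⟩
    simp only [Finset.mem_range] at hk hmax
    have hmax' : ∀ l, v (i (q.coeff l) * b ^ l) ≤ v (i (q.coeff k) * b ^ k) := fun l => by
      rcases lt_or_ge l n with hl | hl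
      · exact hmax l hl
      · rw [coeff_eq_zero_of_natDegree_lt (by lia)]
        simp
    by_cases hz : v (i (q.coeff k) * b ^ k) = 0
    · refine ⟨0, 0, ?_, ?_⟩
      · rw [← hqF, eval₂_eq_sum_range, Finset.sum_eq_zero]
        · simp
        · intro l _
          have := hmax' l
          rwa [hz, le_zero_iff, map_eq_zero] at this
      · rw [← hqG, eval₂_eq_sum_range, Finset.sum_eq_zero]
        · simp
        · intro l _
          have h0 : v (i (q.coeff l) * b ^ l) ≤ v (i 0 * b ^ 0) := by
            exact (hmax' l).trans (by rw [hz]; exact zero_le)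
          simpa using (hle _ _ _ _).1 h0
    · have hdom : ∀ l, l ≠ k → v (i (q.coeff l) * b ^ l) < v (i (q.coeff k) * b ^ k) := by
        intro l hlk
        refine lt_of_le_of_ne (hmax' l) fun heq => hz ?_
        rcases lt_or_gt_of_ne hlk with hl | hl
        · rw [hdist _ _ l k hl hk heq]
          simp
        · rcases lt_or_ge l n with hln | hln
          · rw [← heq, hdist _ _ k l hl hln heq.symm]
            simp
          · rw [← heq, coeff_eq_zero_of_natDegree_lt (by lia)]
            simp
      refine ⟨q.coeff k, k, ?_, ?_⟩
      · rw [← hqF, Valuation.eval₂_eq_of_dominant hdom]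
      · rw [← hqG, Valuation.eval₂_eq_of_dominant fun l hl => (hlt _ _ _ _).1 (hdom l hl)]
  · rw [Valuation.exists_eq_pow_iff_pow hn, hb', h.pow_iff _ _ (mul_ne_zero hm hn), ← hc',
      ← Valuation.exists_eq_pow_iff_pow hn]

lemma IsMaximal.exists_pow [Field A] {i : A →+* F} {j : A →+* G}
    (h : IsMaximal v π w ϖ i j) (hv : IsLaurentLike v π) (hw : IsLaurentLike w ϖ) {n : ℕ}
    (hn : n ≠ 0) (r : A) (hr : ∃ y, v (i r) = v y ^ n) : ∃ s, v (i r) = v (i s) ^ n := by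
  induction n using Nat.strong_induction_on generalizing r with
  | _ n ih =>
    by_contra! hcon
    have hr0 : i r ≠ 0 := fun h0 => hcon 0 (by simp [h0, hn])
    obtain ⟨b, hb⟩ := (hv.exists_pow_eq_iff hn (i r)).2 hr
    obtain ⟨c, hc⟩ := (hw.exists_pow_eq_iff hn (j r)).2 ((h.pow_iff r n hn).1 hr)
    have hb0 : b ≠ 0 := by
      rintro rfl
      rw [zero_pow hn] at hb
      exact hr0 hb
    have hb0' : v b ≠ 0 := by simpa using hb0
    have hdist : ∀ s t k l, k < l → l < n → v (i s * b ^ k) = v (i t * b ^ l) → t = 0 := by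
      intro s t k l hkl hln hst
      by_contra ht
      have ht0 : v (i t) ≠ 0 := by simpa using ht
      have hkey : v (i (s / t)) = v b ^ (l - k) := by
        rw [map_mul, map_mul, map_pow, map_pow] at hst
        rw [map_div₀, map_div₀, div_eq_iff ht0]
        refine mul_right_cancel₀ (pow_ne_zero k hb0') ?_
        rw [hst, mul_right_comm, ← pow_add, Nat.sub_add_cancel hkl.le, mul_comm]
      have hlk : l - k ≠ 0 := by lia
      obtain ⟨z, hz⟩ := ih (l - k) (by lia) hlk (s / t) ⟨b, hkey⟩
      rw [hkey, pow_left_inj₀ zero_le zero_le hlk] at hz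
      exact hcon z (by rw [hb, map_pow, hz])
    obtain ⟨a, ha, -⟩ := h.max b c (h.adjoin_radical hn hb.symm hc.symm hdist)
    exact hcon a (by rw [ha, hb, map_pow])

end PartialIso

end Purity

section ResidueField

open Polynomial

variable {F Γ G Δ A : Type*} [Field F] [LinearOrderedCommGroupWithZero Γ]
    [Field G] [LinearOrderedCommGroupWithZero Δ] [Field A]
    {v : Valuation F Γ} {π : F} {w : Valuation G Δ} {ϖ : G} {i : A →+* F} {j : A →+* G}

namespace Valuation

lemma eval₂_le_one {p : A[X]} (hp : ∀ k, v (i (p.coeff k)) ≤ 1) {x : F} (hx : v x ≤ 1) :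
    v (p.eval₂ i x) ≤ 1 := by
  rw [← eval_map]
  exact eval_le_one (by simpa using hp) hx

lemma exists_finset_residue_root {m : ℕ}
    (H : ∀ p : A[X], p.Monic → p.natDegree ≠ 0 → p.natDegree < m →
      (∀ k, v (i (p.coeff k)) ≤ 1) → ∃ a, v (i a) ≤ 1 ∧ v (i (p.eval a)) < 1)
    (s : A[X]) (hs : s.natDegree < m) (h_int : ∀ k, v (i (s.coeff k)) ≤ 1)
    (hunit : ∃ k, v (i (s.coeff k)) = 1) :
    ∃ R : Finset A, (∀ r ∈ R, v (i r) ≤ 1) ∧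
      ∀ x, v x ≤ 1 → v (s.eval₂ i x) < 1 → ∃ r ∈ R, v (x - i r) < 1 := by
  classical
  induction hd : s.natDegree using Nat.strong_induction_on generalizing s with
  | _ d ih =>
    subst hd
    obtain ⟨k, hk⟩ := hunit
    rcases eq_or_ne s.natDegree 0 with hd0 | hd0
    · refine ⟨∅, by simp, fun x _ hlt => ?_⟩
      rw [eq_C_of_natDegree_eq_zero hd0] at hlt hk
      rw [coeff_C] at hk
      split_ifs at hk
      · rw [eval₂_C, hk] at hlt
        exact absurd hlt (lt_irrefl _)
      · simp at hk
    rcases lt_or_eq_of_le (h_int s.natDegree) with hlc | hlc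
    · have hk' : k ≠ s.natDegree := by
        rintro rfl
        exact hlc.ne hk
      have hlt : s.eraseLead.natDegree < s.natDegree := by
        have := eraseLead_natDegree_le s
        lia
      obtain ⟨R, hR, hRx⟩ := ih _ hlt s.eraseLead (hlt.trans hs)
        (fun l => by
          rw [eraseLead_coeff]
          split_ifs
          · simp
          · exact h_int l)
        ⟨k, by rw [eraseLead_coeff_of_ne _ hk', hk]⟩ rfl
      refine ⟨R, hR, fun x hx hsx => hRx x hx ?_⟩
      have : s.eraseLead.eval₂ i x = s.eval₂ i x - i (s.coeff s.natDegree) * x ^ s.natDegree := by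
        rw [eq_sub_iff_add_eq]
        conv_rhs => rw [← eraseLead_add_C_mul_X_pow s]
        rw [eval₂_add, eval₂_mul, eval₂_C, eval₂_X_pow, leadingCoeff]
      rw [this]
      refine v.map_sub_lt hsx ?_
      rw [map_mul, map_pow]
      exact mul_lt_one_of_lt_of_le hlc (pow_le_one' hx _)
    · have hlc0 : s.leadingCoeff ≠ 0 := by
        intro h0
        rw [leadingCoeff] at h0
        simp [h0] at hlc
      set t := C s.leadingCoeff⁻¹ * s with ht
      have htm : t.Monic := by
        rw [ht, mul_comm]
        exact monic_mul_leadingCoeff_inv (by simpa using hlc0)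
      have htd : t.natDegree = s.natDegree := natDegree_C_mul (inv_ne_zero hlc0)
      have htint : ∀ l, v (i (t.coeff l)) ≤ 1 := fun l => by
        rw [ht, coeff_C_mul, map_mul, map_mul, leadingCoeff, map_inv₀, map_inv₀, hlc, inv_one,
          one_mul]
        exact h_int l
      obtain ⟨r, hr, hr1⟩ := H t htm (by rwa [htd]) (by rwa [htd]) htint
      set q := (taylor r t).divX with hq
      have hqd : q.natDegree = s.natDegree - 1 := by
        rw [hq, natDegree_divX_eq_natDegree_tsub_one, natDegree_taylor, htd]
      have hqint : ∀ l, v (i (q.coeff l)) ≤ 1 := fun l => by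
        rw [hq, coeff_divX]
        exact taylor_coeff_le_one (v := v.comap i) htint hr _
      have hqunit : v (i (q.coeff (s.natDegree - 1))) = 1 := by
        rw [hq, coeff_divX, Nat.sub_add_cancel (Nat.pos_of_ne_zero hd0), ← htd,
          coeff_taylor_natDegree, htm.leadingCoeff, map_one, map_one]
      obtain ⟨R, hR, hRx⟩ := ih _ (by lia : s.natDegree - 1 < s.natDegree) q (by lia) hqint
        ⟨_, hqunit⟩ hqd
      refine ⟨insert r (R.image (· + r)), ?_, fun x hx hsx => ?_⟩
      · intro a ha
        rcases Finset.mem_insert.1 ha with rfl | ha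
        · exact hr
        · obtain ⟨b, hb, rfl⟩ := Finset.mem_image.1 ha
          rw [map_add]
          exact v.map_add_le (hR b hb) hr
      have hxr : v (x - i r) ≤ 1 := v.map_sub_le hx hr
      have key : t.eval₂ i x = q.eval₂ i (x - i r) * (x - i r) + i (t.eval r) := by
        have h1 : (taylor r t).eval₂ i (x - i r) = t.eval₂ i x := by
          rw [taylor_apply, eval₂_comp]
          simp
        rw [← h1, ← divX_mul_X_add (taylor r t), taylor_coeff_zero]
        simp [hq]
      have hprod : v (q.eval₂ i (x - i r) * (x - i r)) < 1 := by
        rw [eq_sub_of_add_eq key.symm]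
        refine v.map_sub_lt ?_ hr1
        rw [ht, eval₂_mul, eval₂_C, map_mul, leadingCoeff, map_inv₀, map_inv₀, hlc, inv_one,
          one_mul]
        exact hsx
      rcases lt_or_eq_of_le hxr with hlt | heq
      · exact ⟨r, Finset.mem_insert_self _ _, hlt⟩
      · rw [map_mul, heq, mul_one] at hprod
        obtain ⟨a, ha, hxa⟩ := hRx _ hxr hprod
        refine ⟨a + r, Finset.mem_insert_of_mem (Finset.mem_image_of_mem _ ha), ?_⟩
        rw [map_add, add_comm, ← sub_sub]
        exact hxa

lemma exists_max_coeff (v : Valuation F Γ) (p : A[X]) (hp : p ≠ 0) (i : A →+* F) :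
    ∃ k, p.coeff k ≠ 0 ∧ ∀ l, v (i (p.coeff l)) ≤ v (i (p.coeff k)) := by
  obtain ⟨k, hk, hmax⟩ := Finset.exists_max_image p.support (fun k => v (i (p.coeff k)))
    (by simpa using hp)
  refine ⟨k, by simpa using hk, fun l => ?_⟩
  by_cases hl : l ∈ p.support
  · exact hmax l hl
  · rw [notMem_support_iff.1 hl]
    simp

lemma inv_mul_coeff_le_one {p : A[X]} {k : ℕ}
    (hmax : ∀ l, v (i (p.coeff l)) ≤ v (i (p.coeff k))) (l : ℕ) :
    v (i ((C (p.coeff k)⁻¹ * p).coeff l)) ≤ 1 := by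
  rw [coeff_C_mul, map_mul, map_mul, map_inv₀, map_inv₀]
  exact inv_mul_le_one_of_le₀ (hmax l) zero_le

/-- A polynomial takes the value of its largest coefficient `p.coeff k` at an integral element
at which the primitive polynomial `p / p.coeff k` does not vanish in the residue field. -/
lemma eval₂_eq_max_coeff {p : A[X]} {k : ℕ} (hk : p.coeff k ≠ 0)
    (hmax : ∀ l, v (i (p.coeff l)) ≤ v (i (p.coeff k))) {x : F} (hx : v x ≤ 1)
    (h : ¬ v ((C (p.coeff k)⁻¹ * p).eval₂ i x) < 1) :
    v (p.eval₂ i x) = v (i (p.coeff k)) := by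
  have hk' : v (i (p.coeff k)) ≠ 0 := by simpa using hk
  have h1 : v ((C (p.coeff k)⁻¹ * p).eval₂ i x) = 1 := by
    exact le_antisymm (eval₂_le_one (inv_mul_coeff_le_one hmax) hx) (not_lt.1 h)
  rw [eval₂_mul, eval₂_C, map_mul, map_inv₀, map_inv₀] at h1
  exact ((inv_mul_eq_one₀ hk').1 h1).symm

end Valuation

open Valuation in
lemma IsLaurentLike.exists_generic_root (hv : IsLaurentLike v π) {p : A[X]} (hp : p.Monic)
    (hp0 : p.natDegree ≠ 0) (h_int : ∀ k, v (i (p.coeff k)) ≤ 1)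
    (H : ∀ q : A[X], q.Monic → q.natDegree ≠ 0 → q.natDegree < p.natDegree →
      (∀ k, v (i (q.coeff k)) ≤ 1) → ∃ a, v (i a) ≤ 1 ∧ v (i (q.eval a)) < 1)
    (hcon : ¬ ∃ a, v (i a) ≤ 1 ∧ v (i (p.eval a)) < 1) :
    ∃ b, v b ≤ 1 ∧ p.eval₂ i b = 0 ∧ ∀ q : A[X], q.natDegree < p.natDegree → ∀ k, q.coeff k ≠ 0 →
      (∀ l, v (i (q.coeff l)) ≤ v (i (q.coeff k))) → v (q.eval₂ i b) = v (i (q.coeff k)) := by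
  have hintF : ∀ k, v ((p.map i).coeff k) ≤ 1 := by simpa using h_int
  have hnear : ∀ x, v x ≤ 1 → v (p.eval₂ i x) < 1 → ∀ a, v (i a) ≤ 1 → ¬ v (x - i a) < 1 := by
    intro x hx hpx a ha hxa
    refine hcon ⟨a, ha, ?_⟩
    have h1 := eval_sub_eval_le hintF ha hxa.le
    have h2 := v.map_sub_lt hpx (h1.trans_lt hxa |> fun h => by rwa [eval_map] at h)
    rw [sub_sub_cancel, eval_map, eval₂_hom] at h2
    exact h2
  have hpeel : ∀ s : A[X], s.natDegree < p.natDegree → (∀ k, v (i (s.coeff k)) ≤ 1) →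
      (∃ k, v (i (s.coeff k)) = 1) → ∀ x, v x ≤ 1 → v (p.eval₂ i x) < 1 →
      ¬ v (s.eval₂ i x) < 1 := by
    intro s hs h1 h2 x hx hpx hsx
    obtain ⟨R, hR, hRx⟩ := exists_finset_residue_root H s hs h1 h2
    obtain ⟨r, hr, hxr⟩ := hRx x hx hsx
    exact hnear x hx hpx r (hR r hr) hxr
  obtain ⟨x, hx, hpx⟩ := hv.residue (p.map i) (hp.map i) (by rwa [natDegree_map]) hintF
  rw [eval_map] at hpx
  have hder : ∀ k, v (i (p.derivative.coeff k)) ≤ 1 := fun k => by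
    rw [coeff_derivative, map_mul, map_mul]
    refine mul_le_one' (h_int _) ?_
    exact_mod_cast (v.comap i).natCast_le_one (k + 1)
  have hder1 : v (i (p.derivative.coeff (p.natDegree - 1))) = 1 := by
    obtain ⟨d, hd⟩ := Nat.exists_eq_succ_of_ne_zero hp0
    rw [hd, Nat.succ_sub_one, coeff_derivative, ← Nat.succ_eq_add_one, ← hd, hp.coeff_natDegree,
      one_mul]
    have := hv.natCast (d + 1) (by simp)
    push_cast at this
    simpa using this
  have hder2 : v ((p.map i).derivative.eval x) = 1 := by
    rw [derivative_map, eval_map]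
    refine le_antisymm (eval₂_le_one hder hx) (not_lt.1 ?_)
    exact hpeel _ (natDegree_derivative_lt hp0) hder ⟨_, hder1⟩ x hx hpx
  obtain ⟨b, hbx, hb⟩ := hv.exists_root hintF hx (by rwa [eval_map]) hder2
  have hb1 : v b ≤ 1 := by simpa using v.map_add_le hbx.le hx
  rw [eval_map] at hb
  refine ⟨b, hb1, hb, fun q hq k hk hmax => eval₂_eq_max_coeff hk hmax hb1 ?_⟩
  exact hpeel _ ((natDegree_C_mul_le _ _).trans_lt hq) (inv_mul_coeff_le_one hmax)
    ⟨k, by simp [hk]⟩ b hb1 (by simp [hb])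

namespace PartialIso

lemma IsMaximal.symm (h : IsMaximal v π w ϖ i j) : IsMaximal w ϖ v π j i where
  toPartialIso := h.toPartialIso.symm
  max b c hbc := let ⟨a, h1, h2⟩ := h.max c b hbc.symm; ⟨a, h2, h1⟩

lemma IsMaximal.exists_residue_root (h : IsMaximal v π w ϖ i j) (hv : IsLaurentLike v π)
    (hw : IsLaurentLike w ϖ) (p : A[X]) (hp : p.Monic) (hp0 : p.natDegree ≠ 0)
    (h_int : ∀ k, v (i (p.coeff k)) ≤ 1) : ∃ a, v (i a) ≤ 1 ∧ v (i (p.eval a)) < 1 := by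
  induction hm : p.natDegree using Nat.strong_induction_on generalizing p with
  | _ m ih =>
    subst hm
    by_contra hcon
    have H : ∀ q : A[X], q.Monic → q.natDegree ≠ 0 → q.natDegree < p.natDegree →
        (∀ k, v (i (q.coeff k)) ≤ 1) → ∃ a, v (i a) ≤ 1 ∧ v (i (q.eval a)) < 1 :=
      fun q hq hq0 hlt hqint => ih _ hlt q hq hq0 hqint rfl
    obtain ⟨b, hb1, hb, hbq⟩ := hv.exists_generic_root hp hp0 h_int H hcon
    obtain ⟨c, -, hc, hcq⟩ := hw.exists_generic_root (i := j) hp hp0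
      (by simpa only [h.le_one_iff] using h_int)
      (by simpa only [h.le_one_iff, h.lt_one_iff] using H)
      (by simpa only [h.le_one_iff, h.lt_one_iff] using hcon)
    have hp1 : p ≠ 1 := fun h1 => hp0 (by simp [h1])
    have hext : PartialIso v π w ϖ (eval₂RingHom i b) (eval₂RingHom j c) := by
      refine h.adjoin_immediate fun q => ?_
      set r := q %ₘ p with hr
      have hrd : r.natDegree < p.natDegree := natDegree_modByMonic_lt q hp hp1
      have hrF : r.eval₂ i b = q.eval₂ i b := by
        conv_rhs => rw [← modByMonic_add_div q p]
        simp [hr, hb]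
      have hrG : r.eval₂ j c = q.eval₂ j c := by
        conv_rhs => rw [← modByMonic_add_div q p]
        simp [hr, hc]
      rcases eq_or_ne r 0 with h0 | h0
      · exact ⟨0, by simp [← hrF, h0], by simp [← hrG, h0]⟩
      obtain ⟨k, hk, hmax⟩ := v.exists_max_coeff r h0 i
      refine ⟨r.coeff k, by rw [← hrF, hbq r hrd k hk hmax], ?_⟩
      rw [← hrG, hcq r hrd k hk fun l => (h.le_iff _ _).1 (hmax l)]
    obtain ⟨a, ha, -⟩ := h.max b c hext
    rw [← ha, eval₂_hom, map_eq_zero] at hb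
    exact hcon ⟨a, by rwa [ha], by simp [hb]⟩

lemma IsMaximal.exists_finset_residue_root (h : IsMaximal v π w ϖ i j) (hv : IsLaurentLike v π)
    (hw : IsLaurentLike w ϖ) (s : A[X]) (h_int : ∀ k, v (i (s.coeff k)) ≤ 1)
    (hunit : ∃ k, v (i (s.coeff k)) = 1) :
    ∃ R : Finset A, (∀ r ∈ R, v (i r) ≤ 1) ∧
      ∀ x, v x ≤ 1 → v (s.eval₂ i x) < 1 → ∃ r ∈ R, v (x - i r) < 1 :=
  Valuation.exists_finset_residue_root
    (fun p hp hp0 _ hpint => h.exists_residue_root hv hw p hp hp0 hpint)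
    s (Nat.lt_succ_self _) h_int hunit

end PartialIso

end ResidueField

section PseudoCauchy

open Polynomial Filter

variable {F Γ G Δ A : Type*} [Field F] [LinearOrderedCommGroupWithZero Γ]
    [Field G] [LinearOrderedCommGroupWithZero Δ] [Field A]
    {v : Valuation F Γ} {π : F} {w : Valuation G Δ} {ϖ : G} {i : A →+* F} {j : A →+* G}

/-- A family of balls `{x | u (x - a) ≤ u (e a)}` such as arises from an immediate extension by
an element at distance `u (e a)` from each `a`. -/
structure IsPseudoCauchy (u : Valuation A Γ) (e : A → A) : Prop where
  ne_zero : ∀ a, e a ≠ 0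
  exists_lt : ∀ a, ∃ a', u (e a') < u (e a)
  dist_eq : ∀ a a', u (e a') < u (e a) → u (a' - a) = u (e a)
  dist_le : ∀ a a', u (e a') ≤ u (e a) → u (a' - a) ≤ u (e a)

/-- The filter of sets containing all `a` with `u (e a)` sufficiently small. -/
def nearFilter (u : Valuation A Γ) (e : A → A) : Filter A where
  sets := {s | ∃ a₀, ∀ a, u (e a) ≤ u (e a₀) → a ∈ s}
  univ_sets := ⟨0, fun _ _ => trivial⟩
  sets_of_superset := fun ⟨a₀, h⟩ hst => ⟨a₀, fun a ha => hst (h a ha)⟩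
  inter_sets := by
    rintro s t ⟨a₀, h⟩ ⟨a₁, h'⟩
    rcases le_total (u (e a₀)) (u (e a₁)) with hle | hle
    · exact ⟨a₀, fun a ha => ⟨h a ha, h' a (ha.trans hle)⟩⟩
    · exact ⟨a₁, fun a ha => ⟨h a (ha.trans hle), h' a ha⟩⟩

lemma eventually_nearFilter {u : Valuation A Γ} {e : A → A} {P : A → Prop} :
    (∀ᶠ a in nearFilter u e, P a) ↔ ∃ a₀, ∀ a, u (e a) ≤ u (e a₀) → P a := Iff.rfl

instance nearFilter_neBot (u : Valuation A Γ) (e : A → A) : (nearFilter u e).NeBot := by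
  refine ⟨fun h => ?_⟩
  have h0 : ∀ᶠ _ in nearFilter u e, False := by rw [h]; exact eventually_bot
  obtain ⟨a, ha⟩ := eventually_nearFilter.1 h0
  exact ha a le_rfl

/-- The value of `p` is eventually constant. -/
def IsStable (u : Valuation A Γ) (e : A → A) (p : A[X]) : Prop :=
  ∃ r, ∀ᶠ a in nearFilter u e, u (p.eval a) = u r

namespace PartialIso

lemma nearFilter_eq (h : PartialIso v π w ϖ i j) (e : A → A) :
    nearFilter (v.comap i) e = nearFilter (w.comap j) e := by
  ext s
  exact exists_congr fun a₀ => forall_congr' fun a => imp_congr (h.le_iff _ _) Iff.rfl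

lemma isPseudoCauchy (h : PartialIso v π w ϖ i j) {e : A → A}
    (he : IsPseudoCauchy (v.comap i) e) : IsPseudoCauchy (w.comap j) e where
  ne_zero := he.ne_zero
  exists_lt a := let ⟨a', ha⟩ := he.exists_lt a; ⟨a', (h.lt_iff _ _).1 ha⟩
  dist_eq a a' ha := (h.eq_iff _ _).1 (he.dist_eq a a' ((h.lt_iff _ _).2 ha))
  dist_le a a' ha := (h.le_iff _ _).1 (he.dist_le a a' ((h.le_iff _ _).2 ha))

lemma isStable_iff (h : PartialIso v π w ϖ i j) (e : A → A) (p : A[X]) :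
    IsStable (v.comap i) e p ↔ IsStable (w.comap j) e p := by
  refine exists_congr fun r => ?_
  rw [h.nearFilter_eq]
  exact eventually_congr (Eventually.of_forall fun a => h.eq_iff _ _)

end PartialIso

namespace Valuation

lemma eval₂_eq_taylor_sum (p : A[X]) (i : A →+* F) (a : A) (y : F) :
    p.eval₂ i y = i (p.eval a) + ∑ k ∈ Finset.range p.natDegree,
      i ((hasseDeriv (k + 1) p).eval a) * (y - i a) ^ (k + 1) := by
  have h1 : (taylor a p).eval₂ i (y - i a) = p.eval₂ i y := by
    rw [taylor_apply, eval₂_comp]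
    simp
  rw [← h1, eval₂_eq_sum_range, natDegree_taylor, Finset.sum_range_succ']
  simp [taylor_coeff, add_comm]

lemma eval₂_sub_eval_lt {p : A[X]} {a : A} {y : F} {g T : Γ} (hy : v (y - i a) ≤ g)
    (h : ∀ k, 1 ≤ k → v (i ((hasseDeriv k p).eval a)) * g ^ k < T) :
    v (p.eval₂ i y - i (p.eval a)) < T := by
  have hT : 0 < T := zero_le.trans_lt (h 1 le_rfl)
  rw [eval₂_eq_taylor_sum p i a, add_sub_cancel_left]
  refine v.map_sum_lt hT.ne' fun k _ => ?_
  rw [map_mul, map_pow]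
  exact (mul_le_mul_right (pow_le_pow_left₀ zero_le hy _) _).trans_lt (h (k + 1) (by lia))

/-- The value of a Taylor expansion without constant term one of whose terms dominates. -/
lemma eval₂_sub_eval_eq {p : A[X]} {a : A} {y : F} {m : ℕ} (hm : 1 ≤ m)
    (h : ∀ k, 1 ≤ k → k ≠ m → v (i ((hasseDeriv k p).eval a)) * v (y - i a) ^ k <
      v (i ((hasseDeriv m p).eval a)) * v (y - i a) ^ m) :
    v (p.eval₂ i y - i (p.eval a)) = v (i ((hasseDeriv m p).eval a)) * v (y - i a) ^ m := by
  have hmd : m ≤ p.natDegree := by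
    by_contra hlt
    have := h (m + 1) (by lia) (by lia)
    rw [hasseDeriv_eq_zero_of_lt_natDegree p m (by lia)] at this
    simp at this
  obtain ⟨m, rfl⟩ := Nat.exists_eq_add_of_le' hm
  rw [eval₂_eq_taylor_sum p i a, add_sub_cancel_left, v.map_sum_eq_of_lt (j := m), map_mul, map_pow]
  · simpa using hmd
  · intro k hk
    rw [map_mul, map_pow, map_mul, map_pow]
    exact h (k + 1) (by lia) (by simpa using (Finset.mem_sdiff.1 hk).2)

end Valuation

namespace IsPseudoCauchy

variable {u : Valuation A Γ} {e : A → A} (he : IsPseudoCauchy u e)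

include he

lemma pos (a : A) : 0 < u (e a) := by simpa [zero_lt_iff] using he.ne_zero a

lemma eventually_lt (a₀ : A) : ∀ᶠ a in nearFilter u e, u (e a) < u (e a₀) := by
  obtain ⟨a₁, h1⟩ := he.exists_lt a₀
  exact ⟨a₁, fun a ha => lt_of_le_of_lt ha h1⟩

lemma eventually_lt_or_gt {β γ : Γ} {k l : ℕ} (hkl : k < l) (hγ : γ ≠ 0) :
    (∀ᶠ a in nearFilter u e, β * u (e a) ^ k < γ * u (e a) ^ l) ∨
      ∀ᶠ a in nearFilter u e, γ * u (e a) ^ l < β * u (e a) ^ k := by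
  obtain ⟨m, rfl⟩ := Nat.exists_eq_add_of_lt hkl
  have hred : ∀ a, u (e a) ^ (k + m + 1) = u (e a) ^ (m + 1) * u (e a) ^ k := fun a => by
    rw [← pow_add]
    congr 1
    lia
  by_cases h : ∃ a₀, γ * u (e a₀) ^ (k + m + 1) ≤ β * u (e a₀) ^ k
  · obtain ⟨a₀, h0⟩ := h
    right
    filter_upwards [he.eventually_lt a₀] with a ha
    rw [hred, ← mul_assoc, mul_le_mul_iff_left₀ (pow_pos (he.pos _) _)] at h0
    rw [hred, ← mul_assoc, mul_lt_mul_iff_left₀ (pow_pos (he.pos _) _)]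
    refine lt_of_lt_of_le ?_ h0
    exact mul_lt_mul_of_pos_left (pow_lt_pow_left₀ ha zero_le (by simp)) (zero_lt_iff.2 hγ)
  · push Not at h
    exact Or.inl (Eventually.of_forall h)

lemma exists_dominant (β : ℕ → Γ) (s : Finset ℕ) : (∀ k ∈ s, β k = 0) ∨ ∃ m ∈ s, β m ≠ 0 ∧
    ∀ᶠ a in nearFilter u e, ∀ k ∈ s, k ≠ m → β k * u (e a) ^ k < β m * u (e a) ^ m := by
  classical
  induction s using Finset.induction_on with
  | empty => simp
  | insert l s hl ih =>
    rcases ih with ih | ⟨m, hm, hm0, ih⟩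
    · by_cases hl0 : β l = 0
      · left
        simpa [hl0] using ih
      · right
        refine ⟨l, by simp, hl0, Eventually.of_forall fun a k hk hkl => ?_⟩
        rw [ih k (Finset.mem_of_mem_insert_of_ne hk hkl), zero_mul]
        exact mul_pos (zero_lt_iff.2 hl0) (pow_pos (he.pos _) _)
    · right
      have hlm : l ≠ m := by
        rintro rfl
        exact hl hm
      have key : (∀ᶠ a in nearFilter u e, β l * u (e a) ^ l < β m * u (e a) ^ m) ∨ (β l ≠ 0 ∧
          ∀ᶠ a in nearFilter u e, β m * u (e a) ^ m < β l * u (e a) ^ l) := by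
        by_cases hl0 : β l = 0
        · left
          refine Eventually.of_forall fun a => ?_
          rw [hl0, zero_mul]
          exact mul_pos (zero_lt_iff.2 hm0) (pow_pos (he.pos _) _)
        · rcases lt_or_gt_of_ne hlm with hlt | hlt
          · exact (he.eventually_lt_or_gt hlt hm0).imp_right fun h => ⟨hl0, h⟩
          · exact (he.eventually_lt_or_gt hlt hl0).symm.imp_right fun h => ⟨hl0, h⟩
      rcases key with key | ⟨hl0, key⟩
      · refine ⟨m, by simp [hm], hm0, ?_⟩
        filter_upwards [ih, key] with a h1 h2 k hk hkm
        rcases Finset.mem_insert.1 hk with rfl | hk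
        · exact h2
        · exact h1 k hk hkm
      · refine ⟨l, by simp, hl0, ?_⟩
        filter_upwards [ih, key] with a h1 h2 k hk hkl
        have hk := Finset.mem_of_mem_insert_of_ne hk hkl
        rcases eq_or_ne k m with rfl | hkm
        · exact h2
        · exact (h1 k hk hkm).trans h2

end IsPseudoCauchy

end PseudoCauchy

section Kaplansky

open Polynomial Filter

variable {F Γ G Δ A : Type*} [Field F] [LinearOrderedCommGroupWithZero Γ]
    [Field G] [LinearOrderedCommGroupWithZero Δ] [Field A]
    {v : Valuation F Γ} {π : F} {w : Valuation G Δ} {ϖ : G} {i : A →+* F} {j : A →+* G}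

namespace IsPseudoCauchy

variable {u : Valuation A Γ} {e : A → A} (he : IsPseudoCauchy u e)

include he

lemma eventually_dominant {q : A[X]} (hq : q ≠ 0) (hst : ∀ k, IsStable u e (hasseDeriv k q)) :
    ∀ᶠ a in nearFilter u e, q.eval a ≠ 0 ∧
      ∀ k, 1 ≤ k → u ((hasseDeriv k q).eval a) * u (e a) ^ k < u (q.eval a) := by
  choose r hr using hst
  set s := Finset.range (q.natDegree + 1) with hs
  have hall : ∀ᶠ a in nearFilter u e, ∀ k ∈ s, u ((hasseDeriv k q).eval a) = u (r k) :=
    (eventually_all_finset s).2 fun k _ => hr k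
  rcases he.exists_dominant (fun k => u (r k)) s with h0 | ⟨m, hm, hm0, hdom⟩
  · obtain ⟨a, ha⟩ := hall.exists
    have h1 := ha q.natDegree (by simp [hs])
    rw [h0 q.natDegree (by simp [hs]), hasseDeriv_natDegree_eq_C] at h1
    simp [hq] at h1
  have hz : ∀ k ∉ s, hasseDeriv k q = 0 := fun k hk =>
    hasseDeriv_eq_zero_of_lt_natDegree q k (by simpa [hs] using hk)
  have h0s : 0 ∈ s := by simp [hs]
  have hpos : ∀ a, 0 < u (r m) * u (e a) ^ m := fun a =>
    mul_pos (zero_lt_iff.2 hm0) (pow_pos (he.pos a) _)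
  rcases Nat.eq_zero_or_pos m with rfl | hmpos
  · filter_upwards [hall, hdom] with a h1 h2
    have h3 := h1 0 h0s
    rw [hasseDeriv_zero'] at h3
    refine ⟨fun h4 => ?_, fun k hk => ?_⟩
    · rw [h4, map_zero] at h3
      exact hm0 h3.symm
    · rw [h3]
      by_cases hks : k ∈ s
      · rw [h1 k hks]
        simpa using h2 k hks (by lia)
      · rw [hz k hks]
        simpa using hpos a
  · exfalso
    obtain ⟨a, h1, h2⟩ := (hall.and hdom).exists
    obtain ⟨a', h3, h4⟩ := (hall.and (he.eventually_lt a)).exists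
    have key := Valuation.eval₂_sub_eval_eq (v := u) (i := RingHom.id A) (p := q) (a := a)
      (y := a') hmpos (by
        intro k _ hkm
        rw [RingHom.id_apply, RingHom.id_apply, RingHom.id_apply, he.dist_eq a a' h4, h1 m hm]
        by_cases hks : k ∈ s
        · rw [h1 k hks]
          exact h2 k hks hkm
        · rw [hz k hks]
          simpa using hpos a)
    rw [RingHom.id_apply, RingHom.id_apply, RingHom.id_apply, he.dist_eq a a' h4, h1 m hm] at key
    have h5 := h2 0 h0s hmpos.ne
    have h6 := h1 0 h0s
    have h7 := h3 0 h0s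
    rw [hasseDeriv_zero'] at h6 h7
    rw [← key, pow_zero, mul_one] at h5
    refine absurd h5 (not_lt.2 (u.map_sub_le ?_ ?_))
    · rw [eval₂_id, h7]
    · rw [h6]

end IsPseudoCauchy

lemma IsPseudoCauchy.eventually_eval₂_eq {e : A → A} (he : IsPseudoCauchy (v.comap i) e)
    {q : A[X]} (hq : q ≠ 0) (hst : ∀ k, IsStable (v.comap i) e (hasseDeriv k q)) {b : F}
    (hb : ∀ a, v (b - i a) = v (i (e a))) :
    ∀ᶠ a in nearFilter (v.comap i) e, v (q.eval₂ i b) = v (i (q.eval a)) := by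
  filter_upwards [he.eventually_dominant hq hst] with a ha
  exact v.map_eq_of_sub_lt (Valuation.eval₂_sub_eval_lt (hb a).le ha.2)

end Kaplansky

section Kaplansky

open Polynomial Filter

variable {F Γ G Δ A : Type*} [Field F] [LinearOrderedCommGroupWithZero Γ]
    [Field G] [LinearOrderedCommGroupWithZero Δ] [Field A]
    {v : Valuation F Γ} {π : F} {w : Valuation G Δ} {ϖ : G} {i : A →+* F} {j : A →+* G}

lemma Valuation.eval_lt_one {p : F[X]} (hp : ∀ k, v (p.coeff k) < 1) {x : F} (hx : v x ≤ 1) :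
    v (p.eval x) < 1 := by
  rw [eval_eq_sum_range]
  refine v.map_sum_lt one_ne_zero fun k _ => ?_
  rw [map_mul, map_pow]
  exact mul_lt_one_of_lt_of_le (hp k) (pow_le_one' hx k)

lemma IsLaurentLike.exists_root_of_linear (hv : IsLaurentLike v π) {P : F[X]}
    (h_int : ∀ k, v (P.coeff k) ≤ 1) (hP1 : P.coeff 1 = 1)
    (hPk : ∀ k, 2 ≤ k → v (P.coeff k) < 1) : ∃ z, v z ≤ 1 ∧ P.eval z = 0 := by
  have hx : v (-P.coeff 0) ≤ 1 := by simpa using h_int 0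
  have h0 : P.eval (-P.coeff 0) = P.divX.divX.eval (-P.coeff 0) * (-P.coeff 0) ^ 2 := by
    conv_lhs => rw [← divX_mul_X_add P, ← divX_mul_X_add P.divX, coeff_divX, zero_add, hP1]
    simp
    ring
  have h1 : P.derivative.eval (-P.coeff 0) =
      P.derivative.divX.eval (-P.coeff 0) * (-P.coeff 0) + 1 := by
    conv_lhs => rw [← divX_mul_X_add P.derivative, coeff_derivative, zero_add, hP1]
    simp
  obtain ⟨z, hz, hz0⟩ := hv.exists_root h_int hx (by
    rw [h0, map_mul, map_pow]
    refine mul_lt_one_of_lt_of_le (Valuation.eval_lt_one (fun k => ?_) hx) (pow_le_one' hx 2)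
    rw [coeff_divX, coeff_divX]
    exact hPk _ (by lia)) (by
    rw [h1, ← v.map_one]
    refine v.map_eq_of_sub_lt ?_
    rw [add_sub_cancel_right, map_one, map_mul]
    refine mul_lt_one_of_lt_of_le (Valuation.eval_lt_one (fun k => ?_) hx) hx
    rw [coeff_divX, coeff_derivative, map_mul]
    refine mul_lt_one_of_lt_of_le (hPk _ (by lia)) ?_
    exact_mod_cast v.natCast_le_one (k + 1 + 1))
  exact ⟨z, by simpa using v.map_add_le hz.le hx, hz0⟩

namespace IsPseudoCauchy

lemma eventually_derivative_dominant {u : Valuation A Γ} {e : A → A} (he : IsPseudoCauchy u e)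
    (hnat : ∀ n : ℕ, n ≠ 0 → u (n : A) = 1) {p : A[X]} (hp : ¬ IsStable u e p)
    (hst : ∀ q : A[X], q.natDegree < p.natDegree → IsStable u e q) :
    ∃ a₀, ∀ a, u (e a) ≤ u (e a₀) →
      (∀ k, 1 ≤ k → u ((hasseDeriv k p).eval a) = u ((hasseDeriv k p).eval a₀)) ∧
      p.derivative.eval a ≠ 0 ∧
      (∀ k, 2 ≤ k → u ((hasseDeriv k p).eval a) * u (e a) ^ k <
        u (p.derivative.eval a) * u (e a)) ∧
      u (p.eval a) ≤ u (p.derivative.eval a) * u (e a) := by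
  have hd : p.natDegree ≠ 0 := by
    intro hd
    rw [eq_C_of_natDegree_eq_zero hd] at hp
    exact hp ⟨p.coeff 0, by simp⟩
  have hst' : ∀ k, 1 ≤ k → IsStable u e (hasseDeriv k p) := fun k hk =>
    hst _ ((natDegree_hasseDeriv_le p k).trans_lt (by lia))
  have hder0 : p.derivative ≠ 0 := by
    intro h0
    have h1 : p.derivative.coeff (p.natDegree - 1) = 0 := by rw [h0, coeff_zero]
    obtain ⟨d, hd'⟩ := Nat.exists_eq_succ_of_ne_zero hd
    rw [hd', Nat.succ_sub_one, coeff_derivative, ← Nat.succ_eq_add_one, ← hd', mul_eq_zero,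
      coeff_natDegree, leadingCoeff_eq_zero] at h1
    rcases h1 with h1 | h1
    · simp [h1] at hd
    · have := hnat (d + 1) (by simp)
      push_cast at this
      simp [h1] at this
  have hcomp : ∀ k a, u ((hasseDeriv k p.derivative).eval a) =
      u ((hasseDeriv (k + 1) p).eval a) := by
    intro k a
    have h1 := LinearMap.congr_fun (hasseDeriv_comp (R := A) k 1) p
    rw [LinearMap.comp_apply, hasseDeriv_one', LinearMap.smul_apply] at h1
    rw [h1, eval_smul, nsmul_eq_mul, map_mul, hnat _ (Nat.choose_pos (by lia)).ne', one_mul]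
  have hder : ∀ k, IsStable u e (hasseDeriv k p.derivative) := fun k => by
    obtain ⟨r, hr⟩ := hst' (k + 1) (by lia)
    exact ⟨r, by simpa only [hcomp] using hr⟩
  have hconst : ∀ k, ∃ r, 1 ≤ k → ∀ᶠ a in nearFilter u e, u ((hasseDeriv k p).eval a) = u r := by
    intro k
    by_cases hk : 1 ≤ k
    · obtain ⟨r, hr⟩ := hst' k hk
      exact ⟨r, fun _ => hr⟩
    · exact ⟨0, fun h => absurd h hk⟩
  choose r hr using hconst
  have hall : ∀ᶠ a in nearFilter u e, ∀ k ∈ Finset.Icc 1 p.natDegree,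
      u ((hasseDeriv k p).eval a) = u (r k) :=
    (eventually_all_finset _).2 fun k hk => hr k (Finset.mem_Icc.1 hk).1
  obtain ⟨a₀, h0⟩ := eventually_nearFilter.1 (hall.and (he.eventually_dominant hder0 hder))
  have hdom : ∀ a, u (e a) ≤ u (e a₀) → ∀ k, 2 ≤ k →
      u ((hasseDeriv k p).eval a) * u (e a) ^ k < u (p.derivative.eval a) * u (e a) := by
    intro a ha k hk
    obtain ⟨k, rfl⟩ := Nat.exists_eq_add_of_le' hk
    have := (h0 a ha).2.2 (k + 1) (by lia)
    rw [hcomp] at this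
    rw [pow_succ, ← mul_assoc]
    exact mul_lt_mul_of_pos_right this (he.pos a)
  refine ⟨a₀, fun a ha => ⟨fun k hk => ?_, (h0 a ha).2.1, hdom a ha, ?_⟩⟩
  · by_cases hkd : k ≤ p.natDegree
    · have hk' := Finset.mem_Icc.2 ⟨hk, hkd⟩
      rw [(h0 a ha).1 k hk', (h0 a₀ le_rfl).1 k hk']
    · rw [hasseDeriv_eq_zero_of_lt_natDegree p k (not_le.1 hkd), eval_zero, eval_zero]
  · by_contra! hlt
    refine hp ⟨p.eval a, ?_⟩
    filter_upwards [he.eventually_lt a] with a' ha'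
    have key := Valuation.eval₂_sub_eval_eq (v := u) (i := RingHom.id A) (p := p) (a := a)
      (y := a') le_rfl (by
        intro k hk hk1
        rw [RingHom.id_apply, RingHom.id_apply, RingHom.id_apply, he.dist_eq a a' ha',
          hasseDeriv_one', pow_one]
        exact hdom a ha k (by lia))
    rw [RingHom.id_apply, RingHom.id_apply, RingHom.id_apply, he.dist_eq a a' ha',
      hasseDeriv_one', pow_one, eval₂_id] at key
    exact u.map_eq_of_sub_lt (key.trans_lt hlt)

lemma exists_root_pseudoLimit (hv : IsLaurentLike v π) {e : A → A}
    (he : IsPseudoCauchy (v.comap i) e) {p : A[X]} (hp : ¬ IsStable (v.comap i) e p)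
    (hst : ∀ q : A[X], q.natDegree < p.natDegree → IsStable (v.comap i) e q) :
    ∃ c, p.eval₂ i c = 0 ∧ ∀ a, v (c - i a) = v (i (e a)) := by
  obtain ⟨a₀, h0⟩ := he.eventually_derivative_dominant
    (fun n hn => by simpa using hv.natCast n hn) hp hst
  simp only [Valuation.comap_apply] at h0
  obtain ⟨-, hd0, hk0, hp0⟩ := h0 a₀ le_rfl
  set γ := v (i (e a₀)) with hγ
  have he0 : i (e a₀) ≠ 0 := by simpa using he.ne_zero a₀
  have hγ0 : 0 < γ := he.pos a₀
  set D := i (p.derivative.eval a₀) with hD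
  have hD0 : D ≠ 0 := (map_ne_zero i).2 hd0
  have hDE : 0 < v D * γ := mul_pos (by simpa [zero_lt_iff] using hD0) hγ0
  set P : F[X] := C (D * i (e a₀))⁻¹ * ((taylor a₀ p).map i).comp (C (i (e a₀)) * X) with hP
  have hcoeff : ∀ k, P.coeff k =
      (D * i (e a₀))⁻¹ * (i ((hasseDeriv k p).eval a₀) * i (e a₀) ^ k) := fun k => by
    rw [hP, coeff_C_mul, comp_C_mul_X_coeff, coeff_map, taylor_coeff]
  have hval : ∀ k, v (P.coeff k) = (v D * γ)⁻¹ * (v (i ((hasseDeriv k p).eval a₀)) * γ ^ k) :=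
    fun k => by rw [hcoeff]; simp [hγ]
  have hP1 : P.coeff 1 = 1 := by
    rw [hcoeff, hasseDeriv_one', pow_one, ← hD, inv_mul_cancel₀ (mul_ne_zero hD0 he0)]
  have hPk : ∀ k, 2 ≤ k → v (P.coeff k) < 1 := fun k hk => by
    rw [hval]
    exact (inv_mul_lt_one₀ hDE).2 (hk0 k hk)
  have hP0 : v (P.coeff 0) ≤ 1 := by
    rw [hval, hasseDeriv_zero', pow_zero, mul_one]
    exact (inv_mul_le_one₀ hDE).2 hp0
  have h_int : ∀ k, v (P.coeff k) ≤ 1 := fun k => by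
    rcases k with _ | _ | k
    · exact hP0
    · rw [hP1, map_one]
    · exact (hPk _ (by lia)).le
  obtain ⟨z, hz, hPz⟩ := hv.exists_root_of_linear h_int hP1 hPk
  have hTz : ((taylor a₀ p).map i).eval (i (e a₀) * z) = 0 := by
    rw [hP, eval_mul, eval_C, eval_comp, eval_mul, eval_C, eval_X] at hPz
    exact (mul_eq_zero.1 hPz).resolve_left (inv_ne_zero (mul_ne_zero hD0 he0))
  set c := i a₀ + i (e a₀) * z with hc
  have hpc : p.eval₂ i c = 0 := by
    rw [map_taylor, taylor_eval, eval_map, add_comm] at hTz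
    exact hTz
  have hca₀ : v (c - i a₀) ≤ γ := by
    rw [hc, add_sub_cancel_left, map_mul]
    exact mul_le_of_le_one_right' hz
  have hle : ∀ a, v (i (e a)) ≤ γ → v (c - i a) ≤ v (i (e a)) := by
    intro a ha
    obtain ⟨hk, hd0', -, hp'⟩ := h0 a ha
    by_contra! hlt
    have hδ : v (c - i a) ≤ γ := by
      have h1 := v.map_sub_le hca₀ (he.dist_le a₀ a ha)
      rwa [map_sub i, show c - i a₀ - (i a - i a₀) = c - i a by ring] at h1
    have hδ0 : 0 < v (c - i a) := zero_le.trans_lt hlt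
    have hk1 := hk 1 le_rfl
    rw [hasseDeriv_one'] at hk1
    have key := Valuation.eval₂_sub_eval_eq (v := v) (i := i) (p := p) (a := a) (y := c) le_rfl (by
      intro k hk1' hk2
      obtain ⟨k, rfl⟩ := Nat.exists_eq_add_of_le' (show 2 ≤ k by lia)
      have h2 := hk0 (k + 2) (by lia)
      rw [hk _ hk1', hasseDeriv_one', hk1]
      rw [show k + 2 = k + 1 + 1 from rfl, pow_succ, ← mul_assoc,
        mul_lt_mul_iff_left₀ hγ0] at h2
      rw [show k + 2 = k + 1 + 1 from rfl, pow_succ, ← mul_assoc, pow_one,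
        mul_lt_mul_iff_left₀ hδ0]
      exact (mul_le_mul_right (pow_le_pow_left₀ zero_le hδ _) _).trans_lt h2)
    rw [hpc, zero_sub, Valuation.map_neg, hasseDeriv_one', pow_one] at key
    rw [key, mul_le_mul_iff_right₀ (by simpa [zero_lt_iff] using hd0')] at hp'
    exact absurd hlt (not_lt.2 hp')
  refine ⟨c, hpc, fun a => ?_⟩
  obtain ⟨a', h1, h2⟩ := ((he.eventually_lt a).and (he.eventually_lt a₀)).exists
  have h3 := he.dist_eq a a' h1
  rw [Valuation.comap_apply, Valuation.comap_apply, map_sub] at h3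
  rw [← sub_add_sub_cancel c (i a') (i a), ← h3]
  refine v.map_add_eq_of_lt_right ?_
  rw [h3]
  exact (hle a' h2.le).trans_lt h1

end IsPseudoCauchy

namespace PartialIso

lemma IsMaximal.isStable (h : IsMaximal v π w ϖ i j) (hv : IsLaurentLike v π)
    (hw : IsLaurentLike w ϖ) {e : A → A} (he : IsPseudoCauchy (v.comap i) e) (p : A[X]) :
    IsStable (v.comap i) e p := by
  induction hm : p.natDegree using Nat.strong_induction_on generalizing p with
  | _ m ih =>
    subst hm
    by_contra hp
    have hst : ∀ q : A[X], q.natDegree < p.natDegree → IsStable (v.comap i) e q :=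
      fun q hq => ih _ hq q rfl
    have he' := h.isPseudoCauchy he
    obtain ⟨b, hpb, hb⟩ := he.exists_root_pseudoLimit hv hp hst
    obtain ⟨c, hpc, hc⟩ := he'.exists_root_pseudoLimit hw (p := p)
      (by rwa [← h.isStable_iff]) (by simpa only [← h.isStable_iff] using hst)
    have hd : p.natDegree ≠ 0 := by
      intro hd
      rw [eq_C_of_natDegree_eq_zero hd] at hp
      exact hp ⟨p.coeff 0, by simp⟩
    have hext : PartialIso v π w ϖ (eval₂RingHom i b) (eval₂RingHom j c) := by
      refine h.adjoin_immediate fun q => ?_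
      have hrF : (q % p).eval₂ i b = q.eval₂ i b := by
        conv_rhs => rw [← EuclideanDomain.div_add_mod q p]
        simp [hpb]
      have hrG : (q % p).eval₂ j c = q.eval₂ j c := by
        conv_rhs => rw [← EuclideanDomain.div_add_mod q p]
        simp [hpc]
      rcases eq_or_ne (q % p) 0 with h0 | h0
      · exact ⟨0, by simp [← hrF, h0], by simp [← hrG, h0]⟩
      have hrd : ∀ k, (hasseDeriv k (q % p)).natDegree < p.natDegree := fun k =>
        (natDegree_hasseDeriv_le _ k).trans_lt
          ((Nat.sub_le _ _).trans_lt (natDegree_mod_lt q hd))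
      have hF := he.eventually_eval₂_eq h0 (fun k => hst _ (hrd k)) hb
      have hG := he'.eventually_eval₂_eq h0 (fun k => (h.isStable_iff e _).1 (hst _ (hrd k))) hc
      rw [← h.nearFilter_eq] at hG
      obtain ⟨a, h1, h2⟩ := (hF.and hG).exists
      exact ⟨(q % p).eval a, by rw [← hrF, h1], by rw [← hrG, h2]⟩
    obtain ⟨a, ha, -⟩ := h.max b c hext
    have := hb a
    rw [ha, sub_self, map_zero] at this
    exact (he.pos a).ne this

lemma IsMaximal.eventually_eval₂_eq (h : IsMaximal v π w ϖ i j) (hv : IsLaurentLike v π)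
    (hw : IsLaurentLike w ϖ) {e : A → A} (he : IsPseudoCauchy (v.comap i) e) {b : F}
    (hb : ∀ a, v (b - i a) = v (i (e a))) {q : A[X]} (hq : q ≠ 0) :
    ∀ᶠ a in nearFilter (v.comap i) e, v (q.eval₂ i b) = v (i (q.eval a)) :=
  he.eventually_eval₂_eq hq (fun _ => h.isStable hv hw he _) hb

end PartialIso

end Kaplansky

section Approximation

open Polynomial Filter

variable {F Γ G Δ A : Type*} [Field F] [LinearOrderedCommGroupWithZero Γ]
    [Field G] [LinearOrderedCommGroupWithZero Δ] [Field A]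
    {v : Valuation F Γ} {π : F} {w : Valuation G Δ} {ϖ : G} {i : A →+* F} {j : A →+* G}

/-- The element `b` of `F` behaves, for the valuation and divisibility in the value group,
like the generic element of `A` with respect to the ultrafilter `U`. -/
structure IsApproximated (v : Valuation F Γ) (i : A →+* F) (U : Ultrafilter A) (b : F) :
    Prop where
  term : ∀ p : A[X], ∃ r, ∃ k : ℕ, v (p.eval₂ i b) = v (i r * b ^ k) ∧
    ∀ᶠ a in U, v (i (p.eval a)) = v (i (r * a ^ k))
  le : ∀ r s (k l : ℕ), v (i r * b ^ k) ≤ v (i s * b ^ l) ↔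
    ∀ᶠ a in U, v (i (r * a ^ k)) ≤ v (i (s * a ^ l))
  pow : ∀ r (k n : ℕ), n ≠ 0 → ((∃ y, v (i r * b ^ k) = v y ^ n) ↔
    ∀ᶠ a in U, ∃ y, v (i (r * a ^ k)) = v y ^ n)

namespace IsApproximated

lemma of_eventually_eq {U : Ultrafilter A} {b : F}
    (H : ∀ p : A[X], p ≠ 0 → ∀ᶠ a in U, v (p.eval₂ i b) = v (i (p.eval a))) :
    IsApproximated v i U b := by
  have H' (r : A) (k : ℕ) : ∀ᶠ a in U, v (i r * b ^ k) = v (i (r * a ^ k)) := by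
    by_cases hr : r = 0
    · simp [hr]
    · have := H (C r * X ^ k) (mul_ne_zero (by simpa using hr) (pow_ne_zero _ X_ne_zero))
      simpa [eval₂_mul, eval₂_pow] using this
  refine ⟨fun p ↦ ?_, fun r s k l ↦ ?_, fun r k n hn ↦ ?_⟩
  · by_cases hp : p = 0
    · exact ⟨0, 0, by simp [hp]⟩
    · obtain ⟨a, ha⟩ := (H p hp).exists
      refine ⟨p.eval a, 0, by simpa using ha, ?_⟩
      filter_upwards [H p hp] with x hx
      simp [← hx, ha]
  · rw [← eventually_const (f := (U : Filter A)) (p := _ ≤ _)]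
    apply eventually_congr
    filter_upwards [H' r k, H' s l] with x h1 h2
    rw [h1, h2]
  · rw [← eventually_const (f := (U : Filter A)) (p := ∃ y, _)]
    apply eventually_congr
    filter_upwards [H' r k] with x h1
    rw [h1]

end IsApproximated

lemma IsApproximated.of_mem_range (a : A) : IsApproximated v i (pure a : Ultrafilter A) (i a) :=
  .of_eventually_eq fun p _ ↦ by
    simp [eval₂_at_apply]

namespace PartialIso

lemma IsMaximal.isApproximated_of_residue (h : IsMaximal v π w ϖ i j) (hv : IsLaurentLike v π)
    (hw : IsLaurentLike w ϖ) {b : F} (hb : v b ≤ 1) (hba : ∀ a, 1 ≤ v (b - i a)) :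
    ∃ U : Ultrafilter A, IsApproximated v i U b := by
  refine ⟨(hyperfilter ℕ).map (Nat.cast : ℕ → A), .of_eventually_eq fun p hp ↦ ?_⟩
  obtain ⟨k, hk, hmax⟩ := Valuation.exists_max_coeff v p hp i
  obtain ⟨R, -, hR⟩ := h.exists_finset_residue_root hv hw (C (p.coeff k)⁻¹ * p)
    (Valuation.inv_mul_coeff_le_one hmax) ⟨k, by simp [hk]⟩
  have hb' := Valuation.eval₂_eq_max_coeff hk hmax hb fun hlt ↦
    let ⟨r, _, hr⟩ := hR b hb hlt
    not_lt_of_ge (hba r) hr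
  rw [Ultrafilter.coe_map, eventually_map]
  have hN : ∀ᶠ N : ℕ in hyperfilter ℕ, ∀ r ∈ R, 1 ≤ v ((N : F) - i r) := by
    rw [Finset.eventually_all]
    intro r _
    have hs : {N : ℕ | v ((N : F) - i r) < 1}.Subsingleton := by
      have key (M N : ℕ) (hM : v ((M : F) - i r) < 1) (hN : v ((N : F) - i r) < 1)
          (hMN : M < N) : False := by
        have h1 := hv.natCast (N - M) (by lia)
        have h2 := v.map_sub_lt hN hM
        rw [Nat.cast_sub hMN.le] at h1
        rw [sub_sub_sub_cancel_right, h1] at h2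
        exact lt_irrefl _ h2
      intro M hM N hN
      rcases lt_trichotomy M N with h | h | h
      · exact (key M N hM hN h).elim
      · exact h
      · exact (key N M hN hM h).elim
    filter_upwards [hs.finite.compl_mem_hyperfilter] with N hN
    simpa using hN
  filter_upwards [hN] with N hN
  have hN1 : v (i (N : A)) ≤ 1 := by simpa using v.natCast_le_one N
  have h2 := Valuation.eval₂_eq_max_coeff hk hmax hN1 fun hlt ↦ by
    obtain ⟨r, hr, h3⟩ := hR _ hN1 hlt
    rw [map_natCast] at h3
    exact not_lt_of_ge (hN r hr) h3
  rw [hb', ← h2, eval₂_at_apply]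

lemma IsMaximal.isApproximated_of_immediate (h : IsMaximal v π w ϖ i j)
    (hv : IsLaurentLike v π) (hw : IsLaurentLike w ϖ) {b : F}
    (hb : ∀ a, ∃ a', v (b - i a') < v (b - i a)) :
    ∃ U : Ultrafilter A, IsApproximated v i U b := by
  choose f hf using hb
  have hd (a) : v (b - i a) = v (i (f a - a)) := by
    rw [← Valuation.map_sub_eq_of_lt_left v (hf a)]
    simp
  have he : IsPseudoCauchy (v.comap i) (fun a ↦ f a - a) := by
    have hsub (a a' : A) : i (a' - a) = (b - i a) - (b - i a') := by simp
    refine ⟨fun a h0 ↦ ?_, fun a ↦ ⟨f a, ?_⟩, fun a a' hlt ↦ ?_, fun a a' hle ↦ ?_⟩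
    · have := hf a
      rw [hd a, h0, map_zero, map_zero] at this
      exact not_lt_of_ge zero_le this
    · simpa only [Valuation.comap_apply, hd] using hf a
    · simp only [Valuation.comap_apply, ← hd] at hlt ⊢
      rw [hsub, v.map_sub_eq_of_lt_left hlt]
    · simp only [Valuation.comap_apply, ← hd] at hle ⊢
      rw [hsub]
      exact v.map_sub_le le_rfl hle
  exact ⟨.of (nearFilter (v.comap i) fun a ↦ f a - a), .of_eventually_eq fun p hp ↦
    Ultrafilter.of_le _ (h.eventually_eval₂_eq hv hw he hd hp)⟩

end PartialIso

end Approximation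

section Approximation

open Polynomial Filter

variable {F Γ G Δ A : Type*} [Field F] [LinearOrderedCommGroupWithZero Γ]
    [Field G] [LinearOrderedCommGroupWithZero Δ] [Field A]
    {v : Valuation F Γ} {π : F} {w : Valuation G Δ} {ϖ : G} {i : A →+* F} {j : A →+* G}

/-- The elements of `A` between `b` and `a` in value whose value is congruent to that of `b`
modulo `n`-th powers. -/
def cutSet (v : Valuation F Γ) (i : A →+* F) (b : F) (a : A) (n : ℕ) : Set A :=
  {x | v b < v (i x) ∧ v (i x) ≤ v (i a) ∧ ∃ y, v (i x) = v b * v y ^ n}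

/-- The filter on `A` of elements just above `b` in value. -/
def cutFilter (v : Valuation F Γ) (i : A →+* F) (b : F) (hb : v b < 1) : Filter A where
  sets := {s | ∃ a n, v b < v (i a) ∧ n ≠ 0 ∧ cutSet v i b a n ⊆ s}
  univ_sets := ⟨1, 1, by simpa, one_ne_zero, Set.subset_univ _⟩
  sets_of_superset := fun ⟨a, n, ha, hn, h⟩ hst => ⟨a, n, ha, hn, h.trans hst⟩
  inter_sets := by
    rintro s t ⟨a, n, ha, hn, h⟩ ⟨a', n', ha', hn', h'⟩
    have key (a'' : A) (ha'' : v b < v (i a'')) (h1 : v (i a'') ≤ v (i a))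
        (h2 : v (i a'') ≤ v (i a')) : ∃ a n, v b < v (i a) ∧ n ≠ 0 ∧ cutSet v i b a n ⊆ s ∩ t := by
      refine ⟨a'', n * n', ha'', mul_ne_zero hn hn', fun x ⟨hx, hxa, y, hy⟩ ↦
        ⟨h ⟨hx, hxa.trans h1, y ^ n', ?_⟩, h' ⟨hx, hxa.trans h2, y ^ n, ?_⟩⟩⟩
      · rw [hy, map_pow, ← pow_mul, mul_comm n]
      · rw [hy, map_pow, ← pow_mul]
    rcases le_total (v (i a)) (v (i a')) with hle | hle
    · exact key a ha le_rfl hle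
    · exact key a' ha' hle le_rfl

lemma PartialIso.cutFilter_neBot (h : PartialIso v π w ϖ i j) (hv : IsLaurentLike v π) {b : F}
    (hb : v b < 1) (hba : ∀ a, v b ≠ v (i a)) : (cutFilter v i b hb).NeBot := by
  have hb0 : b ≠ 0 := by
    rintro rfl
    exact hba 0 (by simp)
  refine ⟨fun hbot ↦ ?_⟩
  obtain ⟨a, n, ha, hn, hs⟩ : ∅ ∈ cutFilter v i b hb := hbot ▸ mem_bot
  obtain ⟨p, hp, -⟩ := h.unif
  obtain ⟨z, k, hk, hz⟩ := hv.div n hn (b / i a)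
  have ha0 : v (i a) ≠ 0 := (zero_le.trans_lt ha).ne'
  have hvb : v b ≠ 0 := by simpa
  have hz0 : v z ≠ 0 := by
    intro h0
    rw [h0, zero_pow hn, zero_mul, map_div₀] at hz
    exact (div_ne_zero hvb ha0) hz
  have hlt (m : ℕ) : v b < v (i (a * p ^ m)) := by
    induction m with
    | zero => simpa
    | succ m ih =>
      refine lt_of_le_of_ne ?_ (hba _)
      have := hv.le_mul_unif ih
      rwa [← map_mul, ← hp, ← map_mul, mul_assoc, ← pow_succ] at this
  refine hs (⟨hlt k, ?_, z⁻¹, ?_⟩ : a * p ^ k ∈ cutSet v i b a n)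
  · rw [map_mul, map_mul, map_pow, map_pow, hp]
    exact mul_le_of_le_one_right zero_le (pow_le_one' hv.unif_lt.le k)
  · rw [map_mul, map_mul, map_pow, map_pow, hp, map_inv₀]
    rw [map_div₀, div_eq_iff ha0] at hz
    rw [hz, inv_pow]
    field_simp

namespace IsCut

variable {b : F} (hb : v b < 1)

lemma eventually_lt : ∀ᶠ x in cutFilter v i b hb, v b < v (i x) :=
  ⟨1, 1, by simpa, one_ne_zero, fun _ hx ↦ hx.1⟩

lemma eventually_le {a : A} (ha : v b < v (i a)) :
    ∀ᶠ x in cutFilter v i b hb, v (i x) ≤ v (i a) :=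
  ⟨a, 1, ha, one_ne_zero, fun _ hx ↦ hx.2.1⟩

lemma eventually_exists_eq {n : ℕ} (hn : n ≠ 0) :
    ∀ᶠ x in cutFilter v i b hb, ∃ y, v (i x) = v b * v y ^ n :=
  ⟨1, n, by simpa, hn, fun _ hx ↦ hx.2.2⟩

lemma eventually_pow_iff (r : A) (k : ℕ) {n : ℕ} (hn : n ≠ 0) :
    ∀ᶠ x in cutFilter v i b hb, (∃ y, v (i r * b ^ k) = v y ^ n) ↔
      ∃ y, v (i (r * x ^ k)) = v y ^ n := by
  filter_upwards [eventually_lt hb, eventually_exists_eq hb hn] with x hx ⟨y, hy⟩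
  have hy0 : v y ≠ 0 := by
    intro h0
    rw [h0, zero_pow hn, mul_zero] at hy
    exact (zero_le.trans_lt hx).ne' hy
  rw [v.exists_eq_pow_iff_mul_pow (i r * b ^ k) hy0 k]
  simp only [map_mul, map_pow, hy, mul_pow, ← pow_mul]
  simp only [mul_assoc, mul_comm n k]

end IsCut

open IsCut

namespace PartialIso

lemma IsMaximal.eq_of_mul_pow_eq (h : IsMaximal v π w ϖ i j)
    (hv : IsLaurentLike v π) (hw : IsLaurentLike w ϖ) {b : F} (hba : ∀ a, v b ≠ v (i a))
    {r s : A} (hs : s ≠ 0) {k l : ℕ} (hkl : v (i r * b ^ k) = v (i s * b ^ l)) : k = l := by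
  have hb0 : v b ≠ 0 := by
    simpa using hba 0
  have hs0 : v (i s) ≠ 0 := by simpa
  have hr0 : v (i r) ≠ 0 := by
    intro h0
    rw [map_mul, h0, zero_mul] at hkl
    simp_all
  have key {r s : A} (hs0 : v (i s) ≠ 0) {k l : ℕ} (hlt : k < l)
      (hkl : v (i r) * v b ^ k = v (i s) * v b ^ l) : False := by
    obtain ⟨m, rfl⟩ := Nat.exists_eq_add_of_lt hlt
    have h1 : v (i (r / s)) = v b ^ (m + 1) := by
      rw [map_div₀, map_div₀, div_eq_iff hs0]
      have : v b ^ k ≠ 0 := pow_ne_zero _ hb0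
      apply mul_right_cancel₀ this
      rw [hkl]
      simp only [pow_add]
      ac_rfl
    obtain ⟨t, ht⟩ := h.exists_pow hv hw (Nat.succ_ne_zero m) _ ⟨b, h1⟩
    rw [h1] at ht
    exact hba t ((pow_left_inj₀ zero_le zero_le (Nat.succ_ne_zero m)).1 ht)
  simp only [map_mul, map_pow] at hkl
  rcases lt_trichotomy k l with hlt | heq | hlt
  · exact (key hs0 hlt hkl).elim
  · exact heq
  · exact (key hr0 hlt hkl.symm).elim

lemma IsMaximal.eventually_cut_lt (h : IsMaximal v π w ϖ i j)
    (hv : IsLaurentLike v π) (hw : IsLaurentLike w ϖ) {b : F} (hb : v b < 1)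
    (hba : ∀ a, v b ≠ v (i a))
    {r s : A} {k l : ℕ} (hkl : v (i r * b ^ k) < v (i s * b ^ l)) :
    ∀ᶠ x in cutFilter v i b hb, v (i (r * x ^ k)) < v (i (s * x ^ l)) := by
  have hb0 : v b ≠ 0 := by
    simpa using hba 0
  have hs0 : v (i s) ≠ 0 := by
    intro h0
    rw [map_mul v (i s), h0, zero_mul] at hkl
    exact not_lt_of_ge zero_le hkl
  simp only [map_mul, map_pow] at hkl ⊢
  rcases le_or_gt k l with hle | hlt
  · obtain ⟨m, rfl⟩ := Nat.exists_eq_add_of_le hle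
    filter_upwards [eventually_lt hb] with x hx
    have hx0 : 0 < v (i x) := zero_le.trans_lt hx
    rw [pow_add, mul_left_comm, mul_comm] at hkl ⊢
    have h1 := (mul_lt_mul_iff_right₀ (zero_lt_iff.2 (pow_ne_zero k hb0))).1 hkl
    refine (mul_lt_mul_iff_right₀ (pow_pos hx0 k)).2 (h1.trans_le ?_)
    gcongr
  · obtain ⟨m, rfl⟩ := Nat.exists_eq_add_of_lt hlt
    have hm := Nat.succ_ne_zero m
    by_cases hr0 : v (i r) = 0
    · filter_upwards [eventually_lt hb] with x hx
      have hx0 : 0 < v (i x) := zero_le.trans_lt hx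
      rw [hr0, zero_mul]
      exact mul_pos (zero_lt_iff.2 hs0) (pow_pos hx0 l)
    have h1 : v b ^ (m + 1) < v (i (s / r)) := by
      rw [map_div₀, map_div₀, lt_div_iff₀ (zero_lt_iff.2 hr0)]
      refine (mul_lt_mul_iff_left₀ (zero_lt_iff.2 (pow_ne_zero l hb0))).1 (hkl.trans_eq' ?_)
      simp only [pow_add]
      ac_rfl
    obtain ⟨p, hp, -⟩ := h.unif
    have hp0 : v π ≠ 0 := hv.unif_pos.ne'
    obtain ⟨z, t, ht, hz⟩ := hv.div (m + 1) hm (i (s / r))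
    obtain ⟨q, hq⟩ := h.exists_pow hv hw hm (s / r / p ^ t) ⟨z, by
      rw [map_div₀ i, map_pow, hp, map_div₀, hz, map_pow]
      field_simp⟩
    replace hq : v (i (s / r)) = v (i q) ^ (m + 1) * v π ^ t := by
      rw [map_div₀ i, map_pow, hp, map_div₀, map_pow, div_eq_iff (pow_ne_zero _ hp0)] at hq
      exact hq
    have hbq : v b < v (i q) := by
      refine lt_of_pow_lt_pow_left₀ (m + 1) zero_le (h1.trans_le ?_)
      rw [hq]
      exact mul_le_of_le_one_right zero_le (pow_le_one' hv.unif_lt.le t)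
    have hbq' : v b < v (i (q * p)) := by
      refine lt_of_le_of_ne ?_ (hba _)
      rw [map_mul, map_mul, hp]
      exact hv.le_mul_unif hbq
    have hlt' : v (i (q * p)) ^ (m + 1) < v (i (s / r)) := by
      rw [hq, map_mul, map_mul, hp, mul_pow]
      refine (mul_lt_mul_iff_right₀ (pow_pos (zero_le.trans_lt hbq) _)).2 ?_
      exact pow_lt_pow_right_of_lt_one₀ hv.unif_pos hv.unif_lt ht
    filter_upwards [eventually_lt hb, eventually_le hb hbq'] with x hx hx'
    have hx0 : 0 < v (i x) := zero_le.trans_lt hx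
    have h2 : v (i x) ^ (m + 1) < v (i (s / r)) :=
      (pow_le_pow_left₀ zero_le hx' _).trans_lt hlt'
    rw [map_div₀, map_div₀, lt_div_iff₀ (zero_lt_iff.2 hr0)] at h2
    calc _ = (v (i x) ^ (m + 1) * v (i r)) * v (i x) ^ l := by
          simp only [pow_add]
          ac_rfl
      _ < _ := (mul_lt_mul_iff_left₀ (pow_pos hx0 l)).2 h2

lemma IsMaximal.isApproximated_of_cut (h : IsMaximal v π w ϖ i j)
    (hv : IsLaurentLike v π) (hw : IsLaurentLike w ϖ) {b : F} (hb : v b < 1)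
    (hba : ∀ a, v b ≠ v (i a)) : ∃ U : Ultrafilter A, IsApproximated v i U b := by
  have := h.cutFilter_neBot hv hb hba
  have hb0 : v b ≠ 0 := by
    simpa using hba 0
  let U : Ultrafilter A := .of (cutFilter v i b hb)
  have hU : (U : Filter A) ≤ cutFilter v i b hb := Ultrafilter.of_le _
  have hlt {r s : A} {k l : ℕ} (hkl : v (i r * b ^ k) < v (i s * b ^ l)) :
      ∀ᶠ x in U, v (i (r * x ^ k)) < v (i (s * x ^ l)) :=
    hU (h.eventually_cut_lt hv hw hb hba hkl)
  refine ⟨U, ⟨fun p ↦ ?_, fun r s k l ↦ ⟨fun hle ↦ ?_, fun hle ↦ ?_⟩, fun r k n hn ↦ ?_⟩⟩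
  · by_cases hp : p = 0
    · exact ⟨0, 0, by simp [hp]⟩
    obtain ⟨k, hk, hmax⟩ := p.support.exists_max_image (fun k ↦ v (i (p.coeff k) * b ^ k))
      (support_nonempty.2 hp)
    rw [mem_support_iff] at hk
    have hdom (l : ℕ) (hl : l ≠ k) :
        v (i (p.coeff l) * b ^ l) < v (i (p.coeff k) * b ^ k) := by
      refine lt_of_le_of_ne ?_ fun heq ↦ hl (h.eq_of_mul_pow_eq hv hw hba hk heq)
      by_cases hl0 : p.coeff l = 0
      · simp [hl0]
      · exact hmax l (mem_support_iff.2 hl0)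
    refine ⟨p.coeff k, k, Valuation.eval₂_eq_of_dominant hdom, ?_⟩
    have hdom' : ∀ᶠ x in U, ∀ l ∈ p.support, l ≠ k →
        v (i (p.coeff l * x ^ l)) < v (i (p.coeff k * x ^ k)) := by
      rw [Finset.eventually_all]
      exact fun l _ ↦ eventually_imp_distrib_left.2 fun hl ↦ hlt (hdom l hl)
    filter_upwards [hdom', hU (eventually_lt hb)] with x hx hx0
    replace hx0 : v (i x) ≠ 0 := (zero_le.trans_lt hx0).ne'
    rw [← eval₂_at_apply, map_mul i, map_pow i]
    refine Valuation.eval₂_eq_of_dominant fun l hl ↦ ?_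
    by_cases hl0 : p.coeff l = 0
    · simp only [hl0, map_zero, zero_mul, zero_lt_iff, map_mul, map_pow]
      exact mul_ne_zero (by simpa) (pow_ne_zero _ hx0)
    · simpa using hx l (mem_support_iff.2 hl0) hl
  · rcases hle.lt_or_eq with hlt' | heq
    · exact (hlt hlt').mono fun _ ↦ le_of_lt
    · by_cases hs : s = 0
      · subst hs
        have hr : r = 0 := by simpa [hb0, (by simpa using hb0 : b ≠ 0)] using heq
        simp [hr]
      · obtain rfl := h.eq_of_mul_pow_eq hv hw hba hs heq
        simp only [map_mul, map_pow] at heq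
        simp [mul_right_cancel₀ (pow_ne_zero k hb0) heq]
  · by_contra! hlt'
    obtain ⟨x, hx, hx'⟩ := (hle.and (hlt hlt')).exists
    exact not_lt_of_ge hx hx'
  · rw [← eventually_const (f := (U : Filter A)) (p := ∃ y, _)]
    apply eventually_congr
    filter_upwards [hU (eventually_pow_iff hb r k hn)] with x hx
    exact hx

/-- Every element over a maximal partial isomorphism is, up to a fractional linear change of
variable, approximated by elements of the domain. -/
lemma IsMaximal.exists_isApproximated (h : IsMaximal v π w ϖ i j)
    (hv : IsLaurentLike v π) (hw : IsLaurentLike w ϖ) (b : F) :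
    ∃ U : Ultrafilter A, ∃ b', IsApproximated v i U b' ∧
      ∀ K : Subfield F, b' ∈ K → (∀ a, i a ∈ K) → b ∈ K := by
  by_cases himm : ∀ a, ∃ a', v (b - i a') < v (b - i a)
  · obtain ⟨U, hU⟩ := h.isApproximated_of_immediate hv hw himm
    exact ⟨U, b, hU, fun _ hb _ ↦ hb⟩
  push Not at himm
  obtain ⟨a₀, ha₀⟩ := himm
  have hba {K : Subfield F} (hK : b - i a₀ ∈ K) (hi : ∀ a, i a ∈ K) : b ∈ K := by
    simpa using add_mem hK (hi a₀)
  by_cases hval : ∃ a, v (b - i a₀) = v (i a)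
  · obtain ⟨a₁, ha₁⟩ := hval
    by_cases h0 : v (i a₁) = 0
    · rw [h0, map_eq_zero, sub_eq_zero] at ha₁
      exact ⟨_, _, .of_mem_range a₀, fun _ hb _ ↦ ha₁ ▸ hb⟩
    have h1 : i a₁ ≠ 0 := by simpa using h0
    obtain ⟨U, hU⟩ := h.isApproximated_of_residue hv hw (b := (b - i a₀) / i a₁)
      (by rw [map_div₀, ha₁, div_self h0]) (fun a ↦ by
        have : (b - i a₀) / i a₁ - i a = (b - i (a₀ + a * a₁)) / i a₁ := by
          simp only [map_add, map_mul]
          field_simp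
          ring
        rw [this, map_div₀, one_le_div₀ (zero_lt_iff.2 h0), ← ha₁]
        exact ha₀ _)
    refine ⟨U, _, hU, fun K hK hi ↦ hba ?_ hi⟩
    simpa [div_mul_cancel₀ _ h1] using mul_mem hK (hi a₁)
  · push Not at hval
    rcases lt_trichotomy (v (b - i a₀)) 1 with hlt | heq | hgt
    · obtain ⟨U, hU⟩ := h.isApproximated_of_cut hv hw hlt hval
      exact ⟨U, _, hU, fun K hK hi ↦ hba hK hi⟩
    · exact (hval 1 (by simpa using heq)).elim
    · obtain ⟨U, hU⟩ := h.isApproximated_of_cut hv hw (b := (b - i a₀)⁻¹)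
        (by rw [map_inv₀]; exact inv_lt_one_of_one_lt₀ hgt) (fun a ha ↦ hval a⁻¹ (by
          rw [map_inv₀, map_inv₀, ← ha, map_inv₀, inv_inv]))
      exact ⟨U, _, hU, fun K hK hi ↦ hba (by simpa using inv_mem hK) hi⟩

end PartialIso

end Approximation

section Ultrapower

open Polynomial Filter

variable {ι F Γ : Type*} [Field F] [LinearOrderedCommGroupWithZero Γ] {U : Ultrafilter ι}

noncomputable instance : LinearOrderedCommGroupWithZero (Germ (U : Filter ι) Γ) :=
  { (inferInstance : LinearOrder (Germ (U : Filter ι) Γ)),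
    (inferInstance : OrderBot (Germ (U : Filter ι) Γ)),
    (inferInstance : GroupWithZero (Germ (U : Filter ι) Γ)),
    (inferInstance : CommMonoid (Germ (U : Filter ι) Γ)) with
    zero_mul := zero_mul
    mul_zero := mul_zero
    isBot_zero := fun x ↦ Germ.inductionOn x fun _ ↦
      Germ.coe_le.2 (Eventually.of_forall fun _ ↦ zero_le)
    mul_lt_mul_of_pos_left := fun a ha b c ↦ by
      revert ha
      refine Germ.inductionOn₃ a b c fun a b c ha hbc ↦ ?_
      refine (Germ.coe_lt (f := a * b) (g := a * c)).2 ?_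
      filter_upwards [Germ.coe_pos.1 ha, Germ.coe_lt.1 hbc] with x hx hx'
      exact mul_lt_mul_of_pos_left hx' hx }

/-- The valuation on an ultrapower. -/
noncomputable def germValuation (U : Ultrafilter ι) (v : Valuation F Γ) :
    Valuation (Germ (U : Filter ι) F) (Germ (U : Filter ι) Γ) where
  toFun := Germ.map v
  map_zero' := congrArg Germ.ofFun (funext fun _ ↦ v.map_zero)
  map_one' := congrArg Germ.ofFun (funext fun _ ↦ v.map_one)
  map_mul' x y := Germ.inductionOn₂ x y fun _ _ ↦
    congrArg Germ.ofFun (funext fun _ ↦ v.map_mul _ _)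
  map_add_le_max' x y := Germ.inductionOn₂ x y fun _ _ ↦ by
    refine le_of_le_of_eq ?_ (Germ.max_def _ _).symm
    exact Germ.coe_le.2 (Eventually.of_forall fun _ ↦ v.map_add _ _)

variable (v : Valuation F Γ)

lemma germValuation_le_iff (f g : ι → F) :
    germValuation U v f ≤ germValuation U v g ↔ ∀ᶠ a in U, v (f a) ≤ v (g a) := Germ.coe_le

lemma germValuation_eq_iff (f g : ι → F) :
    germValuation U v f = germValuation U v g ↔ ∀ᶠ a in U, v (f a) = v (g a) := Germ.coe_eq

lemma germ_exists_iff {β : Type*} [Nonempty β] (P : ι → β → Prop)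
    (Q : Germ (U : Filter ι) β → Prop) (h : ∀ f : ι → β, Q f ↔ ∀ᶠ a in U, P a (f a)) :
    (∃ x, Q x) ↔ ∀ᶠ a in U, ∃ y, P a y := by
  constructor
  · rintro ⟨x, hx⟩
    induction x using Germ.inductionOn with | _ f
    exact ((h f).1 hx).mono fun a ha ↦ ⟨_, ha⟩
  · intro H
    obtain ⟨f, hf⟩ := H.choice
    exact ⟨f, (h f).2 hf⟩

lemma germValuation_exists_eq_pow_iff (f : ι → F) (n : ℕ) :
    (∃ y, germValuation U v f = germValuation U v y ^ n) ↔
      ∀ᶠ a in U, ∃ y, v (f a) = v y ^ n :=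
  germ_exists_iff _ _ fun _ ↦ Germ.coe_eq

end Ultrapower

section Ultrapower

open Polynomial Filter

/-- The diagonal embedding into an ultrapower. -/
def germConst {ι : Type*} (U : Ultrafilter ι) (F : Type*) [Field F] :
    F →+* Germ (U : Filter ι) F :=
  (Germ.coeRingHom (U : Filter ι)).comp (Pi.constRingHom ι F)

namespace PartialIso

variable {F Γ G Δ A : Type*} [Field F] [LinearOrderedCommGroupWithZero Γ]
    [Field G] [LinearOrderedCommGroupWithZero Δ] [Field A]
    {v : Valuation F Γ} {π : F} {w : Valuation G Δ} {ϖ : G} {i : A →+* F} {j : A →+* G}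

lemma germ (h : PartialIso v π w ϖ i j) {ι : Type*} (U : Ultrafilter ι) :
    PartialIso v π (germValuation U w) (germConst U G ϖ) i ((germConst U G).comp j) where
  le_iff a b := (h.le_iff a b).trans <|
    (eventually_const (f := (U : Filter ι))).symm.trans
      (germValuation_le_iff w (fun _ ↦ j a) (fun _ ↦ j b)).symm
  pow_iff a n hn := (h.pow_iff a n hn).trans <|
    (eventually_const (f := (U : Filter ι))).symm.trans
      (germValuation_exists_eq_pow_iff w (fun _ ↦ j a) n).symm
  unif := let ⟨a, h1, h2⟩ := h.unif; ⟨a, h1, congrArg (germConst U G) h2⟩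

lemma adjoin_germ (h : PartialIso v π w ϖ i j) {U : Ultrafilter A} {b : F}
    (hb : IsApproximated v i U b) :
    PartialIso v π (germValuation U w) (germConst U G ϖ) (eval₂RingHom i b)
      (eval₂RingHom ((germConst U G).comp j) ((fun a ↦ j a : A → G) : Germ (U : Filter A) G)) := by
  set c : Germ (U : Filter A) G := ((fun a ↦ j a : A → G) : Germ (U : Filter A) G) with hc
  have hmon (r : A) (k : ℕ) : ((germConst U G).comp j) r * c ^ k =
      ((fun a ↦ j (r * a ^ k) : A → G) : Germ (U : Filter A) G) := by
    refine congrArg Germ.ofFun (funext fun a ↦ ?_)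
    simp
  have heval (p : A[X]) : p.eval₂ ((germConst U G).comp j) c =
      ((fun a ↦ j (p.eval a) : A → G) : Germ (U : Filter A) G) := by
    have : eval₂RingHom ((germConst U G).comp j) c = (Germ.coeRingHom (U : Filter A)).comp
        (RingHom.pi fun a ↦ j.comp (evalRingHom a)) := by
      refine Polynomial.ringHom_ext (fun r ↦ ?_) ?_
      · rw [coe_eval₂RingHom, eval₂_C]
        exact congrArg Germ.ofFun (funext fun a ↦ by simp)
      · rw [coe_eval₂RingHom, eval₂_X]
        exact congrArg Germ.ofFun (funext fun a ↦ by simp)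
    exact DFunLike.congr_fun this p
  refine (h.germ U).adjoin (fun p ↦ ?_) (fun r s k l ↦ ?_) (fun r k n hn ↦ ?_)
  · obtain ⟨r, k, h1, h2⟩ := hb.term p
    refine ⟨r, k, h1, ?_⟩
    rw [heval, hmon, germValuation_eq_iff]
    exact h2.mono fun a ha ↦ (h.eq_iff _ _).1 ha
  · rw [hb.le, hmon, hmon, germValuation_le_iff]
    exact eventually_congr (.of_forall fun a ↦ h.le_iff _ _)
  · rw [hb.pow r k n hn, hmon, germValuation_exists_eq_pow_iff]
    exact eventually_congr (.of_forall fun a ↦ h.pow_iff _ n hn)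

lemma IsMaximal.exists_germ {F Γ G Δ A : Type u} [Field F] [LinearOrderedCommGroupWithZero Γ]
    [Field G] [LinearOrderedCommGroupWithZero Δ] [Field A]
    {v : Valuation F Γ} {π : F} {w : Valuation G Δ} {ϖ : G} {i : A →+* F} {j : A →+* G}
    (h : IsMaximal v π w ϖ i j) (hv : IsLaurentLike v π) (hw : IsLaurentLike w ϖ) (b : F) :
    ∃ (U : Ultrafilter A) (B : Type u) (_ : Field B) (κ : A →+* B) (i' : B →+* F)
      (j' : B →+* Germ (U : Filter A) G), i'.comp κ = i ∧ j'.comp κ = (germConst U G).comp j ∧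
      IsMaximal v π (germValuation U w) (germConst U G ϖ) i' j' ∧ ∃ x, i' x = b := by
  obtain ⟨U, b', hb', hK⟩ := h.exists_isApproximated hv hw b
  obtain ⟨B, _, κ, i', j', hi, hj, hmax⟩ :=
    (h.toPartialIso.adjoin_germ hb').exists_isMaximal
  have hi' (a : A) : i' (κ (C a)) = i a := by
    rw [← RingHom.comp_apply, hi]; simp
  have hj' (a : A) : j' (κ (C a)) = germConst U G (j a) := by
    rw [← RingHom.comp_apply, hj]; simp
  refine ⟨U, B, _, κ.comp C, i', j', RingHom.ext hi', RingHom.ext hj', hmax, ?_⟩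
  refine hK i'.fieldRange ⟨κ X, ?_⟩ fun a ↦ ⟨_, hi' a⟩
  rw [← RingHom.comp_apply, hi]
  simp

end PartialIso

end Ultrapower

section Ultrapower

open Filter FirstOrder.Language

variable {ι G Δ : Type*} [Field G] [LinearOrderedCommGroupWithZero Δ] {U : Ultrafilter ι}
  {w : Valuation G Δ} {ϖ : G}

lemma ultraproduct_structure_eq :
    letI : LVR.Structure G := valuedStructure w (w ϖ)
    (Ultraproduct.structure : LVR.Structure ((U : Filter ι).Product fun _ ↦ G)) =
      (valuedStructure (germValuation U w) (germValuation U w (germConst U G ϖ)) :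
        LVR.Structure (Germ (U : Filter ι) G)) := by
  let _ : LVR.Structure G := valuedStructure w (w ϖ)
  have hrep (n : ℕ) (x : Fin n → Germ (U : Filter ι) G) :
      ∃ f : Fin n → ι → G, x = fun k ↦ Germ.ofFun (f k) :=
    ⟨fun k ↦ Quotient.out (x k), funext fun k ↦ (Quotient.out_eq (x k)).symm⟩
  refine Language.Structure.ext ?_ ?_
  · ext n f x
    obtain ⟨x, rfl⟩ := hrep n x
    refine (Ultraproduct.funMap_cast f x).trans ?_
    cases f <;> rfl
  · ext n r x
    obtain ⟨x, rfl⟩ := hrep n x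
    refine (@relMap_quotient_mk' LVR _ ((U : Filter ι).productSetoid fun _ ↦ G)
      (Ultraproduct.setoidPrestructure _ U) _ r x).trans ?_
    cases r with
    | dvd => exact (germValuation_le_iff w (x 1) (x 0)).symm
    | N => exact (germValuation_eq_iff w (x 0) fun _ ↦ ϖ).symm
    | pow n => exact (germ_exists_iff (fun a y ↦ x 0 a = y ^ (n : ℕ)) _ fun f ↦ Germ.coe_eq).symm

lemma realize_germ_iff {α : Type*} {n : ℕ} (φ : LVR.BoundedFormula α n) (x : α → G)
    (y : Fin n → G) :
    (letI : LVR.Structure G := valuedStructure w (w ϖ)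
     φ.Realize x y) ↔
    (letI : LVR.Structure (Germ (U : Filter ι) G) :=
      valuedStructure (germValuation U w) (germValuation U w (germConst U G ϖ))
     φ.Realize (germConst U G ∘ x) (germConst U G ∘ y)) := by
  let _ : LVR.Structure G := valuedStructure w (w ϖ)
  rw [← ultraproduct_structure_eq]
  have := Ultraproduct.boundedFormula_realize_cast (u := U) φ (fun a (_ : ι) ↦ x a)
    (fun a (_ : ι) ↦ y a)
  rw [eventually_const] at this
  exact this.symm

end Ultrapower

section Axioms

open FirstOrder.Language Polynomial Filter

namespace LVR

/-- The sum of two terms. -/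
def addTerm {α : Type*} (s t : LVR.Term α) : LVR.Term α := .func LVRFunc.add ![s, t]

/-- The product of two terms. -/
def mulTerm {α : Type*} (s t : LVR.Term α) : LVR.Term α := .func LVRFunc.mul ![s, t]

/-- The constant term `0`. -/
def zeroTerm {α : Type*} : LVR.Term α := .func LVRFunc.zero ![]

/-- The constant term `1`. -/
def oneTerm {α : Type*} : LVR.Term α := .func LVRFunc.one ![]

/-- The numeral `n`. -/
def natTerm {α : Type*} : ℕ → LVR.Term α
  | 0 => zeroTerm
  | n + 1 => addTerm (natTerm n) oneTerm

/-- The power `t ^ n`. -/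
def powTerm {α : Type*} (t : LVR.Term α) : ℕ → LVR.Term α
  | 0 => oneTerm
  | n + 1 => mulTerm (powTerm t n) t

/-- The value at `t` of the polynomial of degree less than `n` with coefficients `c`. -/
def polyTerm {α : Type*} (c : ℕ → LVR.Term α) (t : LVR.Term α) : ℕ → LVR.Term α
  | 0 => zeroTerm
  | n + 1 => addTerm (polyTerm c t n) (mulTerm (c n) (powTerm t n))

/-- The formula stating `v s ≤ v t` in the multiplicative convention. -/
def leFormula {α : Type*} (s t : LVR.Term α) : LVR.Formula α :=
  Relations.formula₂ (L := LVR) LVRRel.dvd t s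

variable {F Γ : Type*} [Field F] [LinearOrderedCommGroupWithZero Γ] (v : Valuation F Γ) (γ : Γ)
  {α : Type*} (x : α → F)

lemma realize_addTerm (s t : LVR.Term α) :
    letI : LVR.Structure F := valuedStructure v γ
    (addTerm s t).realize x = s.realize x + t.realize x := rfl

lemma realize_mulTerm (s t : LVR.Term α) :
    letI : LVR.Structure F := valuedStructure v γ
    (mulTerm s t).realize x = s.realize x * t.realize x := rfl

lemma realize_zeroTerm :
    letI : LVR.Structure F := valuedStructure v γ
    (zeroTerm : LVR.Term α).realize x = 0 := rfl

lemma realize_oneTerm :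
    letI : LVR.Structure F := valuedStructure v γ
    (oneTerm : LVR.Term α).realize x = 1 := rfl

lemma realize_natTerm (n : ℕ) :
    letI : LVR.Structure F := valuedStructure v γ
    (natTerm n : LVR.Term α).realize x = n := by
  induction n with
  | zero => exact Nat.cast_zero.symm
  | succ n ih => rw [natTerm, realize_addTerm, ih, realize_oneTerm, Nat.cast_succ]

lemma realize_powTerm (t : LVR.Term α) (n : ℕ) :
    letI : LVR.Structure F := valuedStructure v γ
    (powTerm t n).realize x = t.realize x ^ n := by
  induction n with
  | zero => exact (pow_zero _).symm
  | succ n ih => rw [powTerm, realize_mulTerm, ih, pow_succ]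

lemma realize_polyTerm (c : ℕ → LVR.Term α) (t : LVR.Term α) (n : ℕ) :
    letI : LVR.Structure F := valuedStructure v γ
    (polyTerm c t n).realize x = ∑ k ∈ Finset.range n, (c k).realize x * t.realize x ^ k := by
  induction n with
  | zero => rfl
  | succ n ih =>
    rw [polyTerm, realize_addTerm, ih, realize_mulTerm, realize_powTerm, Finset.sum_range_succ]

lemma realize_leFormula (s t : LVR.Term α) :
    letI : LVR.Structure F := valuedStructure v γ
    (leFormula s t).Realize x ↔ v (s.realize x) ≤ v (t.realize x) := by
  let _ : LVR.Structure F := valuedStructure v γ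
  exact Formula.realize_rel₂

variable [DecidableEq F]

/-- The value at the extra variable of the polynomial of degree less than `d` with variable
coefficients. -/
def genericPoly (d : ℕ) : LVR.Term (Fin d ⊕ Unit) :=
  polyTerm (fun k ↦ if h : k < d then .var (.inl ⟨k, h⟩) else zeroTerm) (.var (.inr ())) d

lemma realize_genericPoly {d : ℕ} (x : Fin d → F) (y : Unit → F) :
    letI : LVR.Structure F := valuedStructure v γ
    (genericPoly d).realize (Sum.elim x y) = (ofFn d x).eval (y ()) := by
  let _ : LVR.Structure F := valuedStructure v γ
  rw [genericPoly, realize_polyTerm, ofFn_eq_sum_monomial, eval_finsetSum, Finset.sum_range]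
  simp

lemma val_coeff_ofFn_le {d : ℕ} (x : Fin d → F) (hx : ∀ k, v (x k) ≤ 1) (k : ℕ) :
    v ((ofFn d x).coeff k) ≤ 1 := by
  rcases lt_or_ge k d with h | h
  · rw [ofFn_coeff_eq_val_of_lt x h]
    exact hx _
  · rw [ofFn_coeff_eq_zero_of_ge x h, map_zero]
    exact zero_le_one

/-- If the universal closure of a formula transfers, the formula holds for all tuples. -/
lemma forall_realize_of_transfer {M N : Type*} [LVR.Structure M] [LVR.Structure N]
    (H : ∀ φ : LVR.Sentence, M ⊨ φ → N ⊨ φ) {m : ℕ} (φ : LVR.Formula (Fin m))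
    (h : ∀ x : Fin m → M, φ.Realize x) (x : Fin m → N) : φ.Realize x := by
  have := H (BoundedFormula.relabel (n := m) (k := 0) Sum.inr φ).alls
    (BoundedFormula.realize_alls.2 fun x ↦ Formula.realize_relabel_sumInr φ |>.2 (h x))
  exact (Formula.realize_relabel_sumInr φ).1 (BoundedFormula.realize_alls.1 this x)

end LVR

open LVR

variable {F Γ G Δ : Type*} [Field F] [LinearOrderedCommGroupWithZero Γ]
    [Field G] [LinearOrderedCommGroupWithZero Δ]

/-- Valued fields satisfying the same `L_VR`-sentences have the same algebraic properties. -/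
theorem IsLaurentLike.of_transfer {v : Valuation F Γ} {π : F} (hv : IsLaurentLike v π)
    (w : Valuation G Δ) (ϖ : G)
    (H : letI : LVR.Structure F := valuedStructure v (v π)
      letI : LVR.Structure G := valuedStructure w (w ϖ)
      ∀ φ : LVR.Sentence, F ⊨ φ → G ⊨ φ)
    (h0 : ϖ ≠ 0) (h1 : w ϖ < 1) (hle : ∀ x, w x < 1 → w x ≤ w ϖ) : IsLaurentLike w ϖ := by
  classical
  let _ : LVR.Structure F := valuedStructure v (v π)
  let _ : LVR.Structure G := valuedStructure w (w ϖ)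
  have ht {m : ℕ} (φ : LVR.Formula (Fin m)) := forall_realize_of_transfer (M := F) (N := G) H φ
  refine ⟨h0, h1, hle, fun n hn ↦ ?_, fun p hp hp0 hp1 ↦ ?_, fun p hp hd hp1 ↦ ?_,
    fun n hn x ↦ ?_⟩
  · have := ht (m := 0) (leFormula oneTerm (natTerm n))
    simp only [realize_leFormula, realize_oneTerm, realize_natTerm, hv.natCast n hn,
      map_one, le_refl, forall_const] at this
    exact le_antisymm (natCast_mem w.integer n) this
  · set d := p.natDegree
    have := ht (m := d + 2) <| (Formula.iInf fun k ↦ leFormula (.var k) oneTerm) ⊓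
      ∼(leFormula oneTerm (.var 0)) ⊓ leFormula oneTerm (.var 1) ⟹
      Formula.iExs Unit (∼(leFormula oneTerm (.var (.inr ()))) ⊓
        Term.equal (genericPoly (d + 2)) zeroTerm)
    simp only [Formula.realize_imp, Formula.realize_inf, Formula.realize_iInf,
      Formula.realize_not, Formula.realize_iExs, Formula.realize_equal, realize_leFormula,
      realize_oneTerm, realize_zeroTerm, realize_genericPoly, Term.realize_var, map_one, not_le,
      Sum.elim_inr] at this
    have hF (x : Fin (d + 2) → F)
        (hx : ((∀ k, v (x k) ≤ 1) ∧ v (x 0) < 1) ∧ 1 ≤ v (x 1)) :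
        ∃ y : Unit → F, v (y ()) < 1 ∧ (ofFn (d + 2) x).eval (y ()) = 0 := by
      obtain ⟨y, hy, hy0⟩ := hv.hensel (ofFn (d + 2) x) (val_coeff_ofFn_le v x hx.1.1)
        (by rw [ofFn_coeff_eq_val_of_lt x (by lia)]; exact hx.1.2)
        (by rw [ofFn_coeff_eq_val_of_lt x (by lia)]; exact le_antisymm (hx.1.1 _) hx.2)
      exact ⟨fun _ ↦ y, hy, hy0⟩
    obtain ⟨y, hy, hy0⟩ := this hF (toFn (d + 2) p) ⟨⟨fun k ↦ hp k, hp0⟩, hp1.ge⟩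
    rw [ofFn_comp_toFn_eq_id_of_natDegree_lt (by lia)] at hy0
    exact ⟨_, hy, hy0⟩
  · set d := p.natDegree with hd'
    have := ht (m := d + 1) <| (Formula.iInf fun k ↦ leFormula (.var k) oneTerm) ⊓
      Term.equal (.var (Fin.last d)) oneTerm ⟹
      Formula.iExs Unit (leFormula (.var (.inr ())) oneTerm ⊓
        ∼(leFormula oneTerm (genericPoly (d + 1))))
    simp only [Formula.realize_imp, Formula.realize_inf, Formula.realize_iInf,
      Formula.realize_not, Formula.realize_iExs, Formula.realize_equal, realize_leFormula,
      realize_oneTerm, realize_genericPoly, Term.realize_var, map_one, not_le,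
      Sum.elim_inr] at this
    have hF (x : Fin (d + 1) → F) (hx : (∀ k, v (x k) ≤ 1) ∧ x (Fin.last d) = 1) :
        ∃ y : Unit → F, v (y ()) ≤ 1 ∧ v ((ofFn (d + 1) x).eval (y ())) < 1 := by
      have hlt := ofFn_natDegree_lt (by lia) x
      have hc : (ofFn (d + 1) x).coeff d = 1 :=
        (ofFn_coeff_eq_val_of_lt x (Nat.lt_succ_self d)).trans hx.2
      have hdeg : (ofFn (d + 1) x).natDegree = d :=
        le_antisymm (by lia) (le_natDegree_of_ne_zero (by rw [hc]; exact one_ne_zero))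
      obtain ⟨y, hy, hy0⟩ := hv.residue (ofFn (d + 1) x) (by rw [Monic, leadingCoeff, hdeg, hc])
        (by rwa [hdeg]) (val_coeff_ofFn_le v x hx.1)
      exact ⟨fun _ ↦ y, hy, hy0⟩
    obtain ⟨y, hy, hy0⟩ := this hF (toFn (d + 1) p) ⟨fun k ↦ hp1 k, hp⟩
    rw [ofFn_comp_toFn_eq_id_of_natDegree_lt (by lia)] at hy0
    exact ⟨_, hy, hy0⟩
  · have := ht (m := 2) <| Relations.formula₁ (L := LVR) LVRRel.N (.var 1) ⟹
      Formula.iExs Unit (Formula.iSup fun k : Fin n ↦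
        let t : LVR.Term (Fin 2 ⊕ Unit) :=
          mulTerm (powTerm (.var (.inr ())) n) (powTerm (.var (.inl 1)) k)
        leFormula (.var (.inl 0)) t ⊓ leFormula t (.var (.inl 0)))
    simp only [Formula.realize_imp, Formula.realize_inf, Formula.realize_iSup,
      Formula.realize_iExs, realize_leFormula,
      realize_mulTerm, realize_powTerm, Term.realize_var, map_mul, map_pow,
      Sum.elim_inr, Sum.elim_inl, ← le_antisymm_iff] at this
    have hF (x : Fin 2 → F) (hx : v (x 1) = v π) :
        ∃ y : Unit → F, ∃ k : Fin n, v (x 0) = v (y ()) ^ n * v (x 1) ^ (k : ℕ) := by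
      obtain ⟨y, k, hk, hy⟩ := hv.div n hn (x 0)
      exact ⟨fun _ ↦ y, ⟨k, hk⟩, by rw [hx, hy]⟩
    obtain ⟨y, k, hk⟩ := this hF ![x, ϖ] rfl
    exact ⟨_, k, k.2, hk⟩

lemma IsLaurentLike.germ {ι : Type*} {w : Valuation G Δ} {ϖ : G} (hw : IsLaurentLike w ϖ)
    (U : Ultrafilter ι) : IsLaurentLike (germValuation U w) (germConst U G ϖ) := by
  have hlt (f : ι → G) : germValuation U w (f : Germ (U : Filter ι) G) < 1 ↔
      ∀ᶠ a in U, w (f a) < 1 := by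
    rw [← not_le, ← map_one (germValuation U w)]
    refine (germValuation_le_iff w (fun _ ↦ 1) f).not.trans ?_
    simp
  refine hw.of_transfer _ _ (fun φ h ↦ ?_) (by simpa using hw.unif_ne)
    ((hlt fun _ ↦ ϖ).2 (.of_forall fun _ ↦ hw.unif_lt)) fun x hx ↦ ?_
  · have := (realize_germ_iff (U := U) (w := w) (ϖ := ϖ) φ default default).1 h
    rwa [Subsingleton.elim (_ ∘ default) default, Subsingleton.elim (_ ∘ default) default] at this
  · induction x using Germ.inductionOn with
    | _ f => exact (germValuation_le_iff w f fun _ ↦ ϖ).2 (((hlt f).1 hx).mono fun a ↦ hw.unif_le _)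

end Axioms

section QuantifierElimination

open FirstOrder.Language Filter

lemma realize_term_eq {F G Γ Δ A : Type*} [Field F] [LinearOrderedCommGroupWithZero Γ]
    [Field G] [LinearOrderedCommGroupWithZero Δ] [CommRing A] (v : Valuation F Γ) (γ : Γ)
    (w : Valuation G Δ) (δ : Δ) (i : A →+* F) (j : A →+* G) {α : Type*} (t : LVR.Term α)
    (x : α → A) :
    ∃ a, (letI : LVR.Structure F := valuedStructure v γ; t.realize (i ∘ x)) = i a ∧
      (letI : LVR.Structure G := valuedStructure w δ; t.realize (j ∘ x)) = j a := by
  let _ : LVR.Structure F := valuedStructure v γ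
  let _ : LVR.Structure G := valuedStructure w δ
  induction t with
  | var k => exact ⟨x k, rfl, rfl⟩
  | func f ts ih =>
    choose a ha ha' using ih
    simp only [Term.realize, ha, ha']
    cases f with
    | zero => exact ⟨0, i.map_zero.symm, j.map_zero.symm⟩
    | one => exact ⟨1, i.map_one.symm, j.map_one.symm⟩
    | add => exact ⟨a 0 + a 1, (i.map_add _ _).symm, (j.map_add _ _).symm⟩
    | mul => exact ⟨a 0 * a 1, (i.map_mul _ _).symm, (j.map_mul _ _).symm⟩

namespace PartialIso

lemma relMap_iff {F G Γ Δ A : Type*} [Field F] [LinearOrderedCommGroupWithZero Γ]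
    [Field G] [LinearOrderedCommGroupWithZero Δ] [CommRing A] {v : Valuation F Γ} {π : F}
    {w : Valuation G Δ} {ϖ : G} {i : A →+* F} {j : A →+* G} (h : PartialIso v π w ϖ i j)
    (hv : IsLaurentLike v π) (hw : IsLaurentLike w ϖ) {n : ℕ} (r : LVRRel n) (x : Fin n → A) :
    LVRrel v (v π) r (i ∘ x) ↔ LVRrel w (w ϖ) r (j ∘ x) := by
  cases r with
  | dvd => exact h.le_iff _ _
  | N =>
    obtain ⟨p, rfl, rfl⟩ := h.unif
    exact h.eq_iff _ _
  | pow n =>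
    exact (hv.exists_pow_eq_iff n.ne_zero (i (x 0))).trans
      ((h.pow_iff (x 0) n n.ne_zero).trans (hw.exists_pow_eq_iff n.ne_zero (j (x 0))).symm)

/-- Elimination of quantifiers: corresponding tuples under a maximal partial isomorphism satisfy
the same formulas. -/
theorem IsMaximal.realize_iff {α : Type*} {n : ℕ} (φ : LVR.BoundedFormula α n) :
    ∀ {F G Γ Δ A : Type u} [Field F] [LinearOrderedCommGroupWithZero Γ]
    [Field G] [LinearOrderedCommGroupWithZero Δ] [Field A] {v : Valuation F Γ} {π : F}
    {w : Valuation G Δ} {ϖ : G} {i : A →+* F} {j : A →+* G}, IsMaximal v π w ϖ i j →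
    IsLaurentLike v π → IsLaurentLike w ϖ → ∀ (x : α → A) (y : Fin n → A),
    (letI : LVR.Structure F := valuedStructure v (v π); φ.Realize (i ∘ x) (i ∘ y)) ↔
      (letI : LVR.Structure G := valuedStructure w (w ϖ); φ.Realize (j ∘ x) (j ∘ y)) := by
  induction φ with
  | falsum => exact fun _ _ _ _ _ ↦ Iff.rfl
  | equal t₁ t₂ =>
    intro F G Γ Δ A _ _ _ _ _ v π w ϖ i j h hv hw x y
    obtain ⟨a, ha, ha'⟩ := realize_term_eq v (v π) w (w ϖ) i j t₁ (Sum.elim x y)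
    obtain ⟨b, hb, hb'⟩ := realize_term_eq v (v π) w (w ϖ) i j t₂ (Sum.elim x y)
    rw [Sum.comp_elim] at ha ha' hb hb'
    simp only [BoundedFormula.Realize, ha, ha', hb, hb', ← sub_eq_zero (b := i b),
      ← sub_eq_zero (b := j b), ← map_sub]
    exact h.eq_zero_iff _
  | rel r ts =>
    intro F G Γ Δ A _ _ _ _ _ v π w ϖ i j h hv hw x y
    choose a ha ha' using fun k ↦ realize_term_eq v (v π) w (w ϖ) i j (ts k) (Sum.elim x y)
    rw [Sum.comp_elim] at ha ha'
    simp only [BoundedFormula.Realize, ha, ha']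
    exact h.relMap_iff hv hw r a
  | imp φ ψ ihφ ihψ =>
    intro F G Γ Δ A _ _ _ _ _ v π w ϖ i j h hv hw x y
    simp only [BoundedFormula.Realize, ihφ h hv hw x y, ihψ h hv hw x y]
  | all φ ih =>
    have key {F G Γ Δ A : Type u} [Field F] [LinearOrderedCommGroupWithZero Γ]
        [Field G] [LinearOrderedCommGroupWithZero Δ] [Field A] {v : Valuation F Γ} {π : F}
        {w : Valuation G Δ} {ϖ : G} {i : A →+* F} {j : A →+* G} (h : IsMaximal v π w ϖ i j)
        (hv : IsLaurentLike v π) (hw : IsLaurentLike w ϖ) (x : α → A) (y : Fin _ → A)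
        (H : letI : LVR.Structure G := valuedStructure w (w ϖ);
          φ.all.Realize (j ∘ x) (j ∘ y)) :
        letI : LVR.Structure F := valuedStructure v (v π);
          φ.all.Realize (i ∘ x) (i ∘ y) := by
      intro b
      obtain ⟨U, B, _, κ, i', j', rfl, hj, hmax, z, rfl⟩ := h.exists_germ hv hw b
      have h1 := (ih hmax hv (hw.germ U) (κ ∘ x) (Fin.snoc (κ ∘ y) z)).2
      rw [Fin.comp_snoc, Fin.comp_snoc] at h1
      refine h1 ?_
      have h2 := (realize_germ_iff (U := U) φ.all (j ∘ x) (j ∘ y)).1 H (j' z)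
      have h3 : (j' : B → Germ (U : Filter A) G) ∘ κ = germConst U G ∘ j :=
        funext fun a ↦ DFunLike.congr_fun hj a
      rw [← Function.comp_assoc, ← Function.comp_assoc, h3]
      exact h2
    intro F G Γ Δ A _ _ _ _ _ v π w ϖ i j h hv hw x y
    exact ⟨key h.symm hw hv x y, key h hv hw x y⟩

/-- Corresponding tuples under a partial isomorphism satisfy the same formulas. -/
theorem realize_iff {F G Γ Δ A : Type u} [Field F] [LinearOrderedCommGroupWithZero Γ]
    [Field G] [LinearOrderedCommGroupWithZero Δ] [CommRing A] {v : Valuation F Γ} {π : F}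
    {w : Valuation G Δ} {ϖ : G} {i : A →+* F} {j : A →+* G} (h : PartialIso v π w ϖ i j)
    (hv : IsLaurentLike v π) (hw : IsLaurentLike w ϖ) {α : Type*} (φ : LVR.Formula α)
    (x : α → A) :
    (letI : LVR.Structure F := valuedStructure v (v π); φ.Realize (i ∘ x)) ↔
      (letI : LVR.Structure G := valuedStructure w (w ϖ); φ.Realize (j ∘ x)) := by
  obtain ⟨B, _, κ, i', j', rfl, rfl, hmax⟩ := h.exists_isMaximal
  have := hmax.realize_iff φ hv hw (κ ∘ x) default
  rwa [Subsingleton.elim (i' ∘ default) default, Subsingleton.elim (j' ∘ default) default] at this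

end PartialIso

end QuantifierElimination

section Laurent

open Polynomial WithZero

/-- Hensel's lemma for polynomials that need not be monic. -/
lemma IsAdicComplete.exists_mem_eval_eq_zero {R : Type*} [CommRing R] (I : Ideal R)
    [IsAdicComplete I R] (p : R[X]) (h0 : p.coeff 0 ∈ I) (h1 : IsUnit (p.coeff 1)) :
    ∃ y ∈ I, p.eval y = 0 := by
  obtain ⟨u, hu⟩ := h1
  set T : R → R := fun y ↦ y - ↑u⁻¹ * p.eval y with hT
  set q := p.divX.divX with hq
  have hp (y : R) : p.eval y = p.coeff 0 + u * y + y ^ 2 * q.eval y := by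
    conv_lhs => rw [← divX_mul_X_add p, ← divX_mul_X_add p.divX]
    simp only [eval_add, eval_mul, eval_X, eval_C, coeff_divX, zero_add, ← hu, hq]
    ring
  have hT' (y : R) : T y = -(↑u⁻¹ * (p.coeff 0 + y ^ 2 * q.eval y)) := by
    simp only [hT, hp]
    linear_combination -y * u.inv_mul
  have hTI {y : R} (hy : y ∈ I) : T y ∈ I := by
    rw [hT', pow_two, mul_assoc y]
    exact I.neg_mem (I.mul_mem_left _ (I.add_mem h0 (I.mul_mem_right _ hy)))
  have hTT {m : ℕ} {a b : R} (ha : a ∈ I) (hb : b ∈ I) (hab : a - b ∈ I ^ m) :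
      T a - T b ∈ I ^ (m + 1) := by
    obtain ⟨c, hc⟩ := sub_dvd_eval_sub a b q
    have : T a - T b = (a - b) * -(↑u⁻¹ * (a * q.eval a + b * (q.eval a + b * c))) := by
      rw [hT', hT']
      linear_combination -↑u⁻¹ * b ^ 2 * hc
    rw [this, pow_succ]
    exact Ideal.mul_mem_mul hab (I.neg_mem (I.mul_mem_left _
      (I.add_mem (I.mul_mem_right _ ha) (I.mul_mem_right _ hb))))
  have hI (n : ℕ) : T^[n] 0 ∈ I := by
    induction n with
    | zero => exact I.zero_mem
    | succ n ih => rw [Function.iterate_succ_apply']; exact hTI ih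
  have hsucc (n k : ℕ) : T^[n] 0 - T^[n + k] 0 ∈ I ^ n := by
    induction n with
    | zero => simp
    | succ n ih =>
      rw [add_right_comm, Function.iterate_succ_apply', Function.iterate_succ_apply']
      exact hTT (hI _) (hI _) ih
  have hmod {n : ℕ} {a b : R} : a ≡ b [SMOD (I ^ n • ⊤ : Ideal R)] ↔ a - b ∈ I ^ n := by
    rw [SModEq.sub_mem, smul_eq_mul, Ideal.mul_top]
  obtain ⟨y, hy⟩ := IsPrecomplete.prec' (I := I) (fun n ↦ T^[n] 0) fun {m n} hmn ↦ by
    obtain ⟨k, rfl⟩ := Nat.exists_eq_add_of_le hmn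
    exact hmod.2 (hsucc m k)
  simp only [hmod] at hy
  have hyI : y ∈ I := by
    have := I.sub_mem (hI 1) ((pow_one I).le (hy 1))
    rwa [sub_sub_cancel] at this
  refine ⟨y, hyI, ?_⟩
  have hfix : T y - y = 0 := IsHausdorff.haus' (I := I) _ fun n ↦ hmod.2 <| by
    have h2 := (I ^ n).add_mem (Ideal.pow_le_pow_right n.le_succ (hTT hyI (hI n)
      (by simpa using (I ^ n).neg_mem (hy n)))) (Ideal.pow_le_pow_right n.le_succ (hy (n + 1)))
    rw [Function.iterate_succ_apply', sub_add_sub_cancel] at h2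
    rwa [sub_zero]
  have : ↑u⁻¹ * p.eval y = 0 := by linear_combination -hfix
  rwa [Units.mul_right_eq_zero] at this

namespace LaurentSeries

variable {K : Type*} [Field K]

lemma val_lt_one_iff (f : LaurentSeries K) :
    Valued.v f < (1 : ℤᵐ⁰) ↔ Valued.v f ≤ exp (-1 : ℤ) := by
  rcases eq_or_ne f 0 with rfl | hf
  · simp
  rw [← exp_log ((Valuation.ne_zero_iff (Valued.v : Valuation (LaurentSeries K) ℤᵐ⁰)).2 hf),
    ← exp_zero, exp_lt_exp, exp_le_exp]
  lia

lemma val_coe_lt_one_iff (f : PowerSeries K) :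
    Valued.v (f : LaurentSeries K) < (1 : ℤᵐ⁰) ↔ PowerSeries.constantCoeff f = 0 := by
  rw [val_lt_one_iff, valuation_le_iff_coeff_lt_eq_zero]
  constructor
  · intro h
    have := h 0 one_pos
    rwa [← Int.natCast_zero, coeff_coe_powerSeries, PowerSeries.coeff_zero_eq_constantCoeff] at this
  · intro h n hn
    rcases lt_or_ge n 0 with h0 | h0
    · exact (valuation_le_iff_coeff_lt_eq_zero K (D := 0)).1
        (by simpa using (val_le_one_iff_eq_coe K _).2 ⟨f, rfl⟩) n h0
    · obtain rfl : n = 0 := by lia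
      rw [← Int.natCast_zero, coeff_coe_powerSeries, PowerSeries.coeff_zero_eq_constantCoeff, h]

lemma exists_map_eq_of_val_coeff_le (p : (LaurentSeries K)[X])
    (hp : ∀ k, Valued.v (p.coeff k) ≤ (1 : ℤᵐ⁰)) :
    ∃ q : (PowerSeries K)[X], q.map (HahnSeries.ofPowerSeries ℤ K) = p :=
  (mem_lifts p).1 ((lifts_iff_coeff_lifts p).2 fun k ↦ (val_le_one_iff_eq_coe K _).1 (hp k))

/-- The field of Laurent series over an algebraically closed field of characteristic zero. -/
theorem isLaurentLike [IsAlgClosed K] [CharZero K] :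
    IsLaurentLike (Valued.v : Valuation (LaurentSeries K) ℤᵐ⁰) (HahnSeries.single 1 1) := by
  have hπ : (Valued.v (HahnSeries.single 1 1 : LaurentSeries K) : ℤᵐ⁰) = exp (-1 : ℤ) :=
    valuation_single_zpow K 1
  refine ⟨by simp, ?_, fun x hx ↦ ?_, fun n hn ↦ ?_, fun p hp hp0 hp1 ↦ ?_, fun p hp hd hp1 ↦ ?_,
    fun n hn x ↦ ?_⟩
  · rw [hπ, ← exp_zero, exp_lt_exp]
    lia
  · rwa [hπ, ← val_lt_one_iff]
  · have h := (val_coe_lt_one_iff (n : PowerSeries K)).not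
    rw [map_natCast (HahnSeries.ofPowerSeries ℤ K), map_natCast PowerSeries.constantCoeff] at h
    refine le_antisymm ?_ (not_lt.1 (h.2 (Nat.cast_ne_zero.2 hn)))
    exact natCast_mem (Valued.v : Valuation (LaurentSeries K) ℤᵐ⁰).integer n
  · obtain ⟨q, rfl⟩ := exists_map_eq_of_val_coeff_le p hp
    rw [coeff_map, val_coe_lt_one_iff] at hp0
    rw [coeff_map] at hp1
    obtain ⟨y, hy, hy0⟩ := IsAdicComplete.exists_mem_eval_eq_zero (Ideal.span {PowerSeries.X}) q
      (Ideal.mem_span_singleton.2 (PowerSeries.X_dvd_iff.2 hp0))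
      (PowerSeries.isUnit_iff_constantCoeff.2 (isUnit_iff_ne_zero.2
        fun h ↦ ((val_coe_lt_one_iff _).2 h).ne hp1))
    refine ⟨y, (val_coe_lt_one_iff y).2
      (PowerSeries.X_dvd_iff.1 (Ideal.mem_span_singleton.1 hy)), ?_⟩
    rw [eval_map, eval₂_at_apply, hy0, map_zero]
  · obtain ⟨q, rfl⟩ := exists_map_eq_of_val_coeff_le p hp1
    have hinj : Function.Injective (HahnSeries.ofPowerSeries ℤ K) :=
      HahnSeries.ofPowerSeries_injective
    rw [hinj.monic_map_iff.symm] at hp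
    rw [natDegree_map_eq_of_injective hinj] at hd
    obtain ⟨c, hc⟩ := IsAlgClosed.exists_root (q.map PowerSeries.constantCoeff) (by
      rw [hp.degree_map, degree_eq_natDegree hp.ne_zero]
      exact_mod_cast hd)
    refine ⟨HahnSeries.ofPowerSeries ℤ K (PowerSeries.C c),
      (val_le_one_iff_eq_coe K _).2 ⟨_, rfl⟩, ?_⟩
    rw [eval_map, eval₂_at_apply, val_coe_lt_one_iff, ← eval₂_at_apply, ← eval_map,
      PowerSeries.constantCoeff_C]
    exact hc
  · rcases eq_or_ne x 0 with rfl | hx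
    · exact ⟨0, 0, Nat.pos_of_ne_zero hn, by simp [hn]⟩
    have hn' : (n : ℤ) ≠ 0 := by exact_mod_cast hn
    set m := log (Valued.v x : ℤᵐ⁰) with hm
    have hmod := Int.emod_nonneg (-m) hn'
    have hmod' := Int.emod_lt_of_pos (-m) (by lia : (0 : ℤ) < n)
    refine ⟨HahnSeries.single (-m / n) 1, (-m % n).toNat, by lia, ?_⟩
    rw [← exp_log ((Valuation.ne_zero_iff (Valued.v : Valuation (LaurentSeries K) ℤᵐ⁰)).2 hx),
      ← hm, hπ, valuation_single_zpow, ← exp_nsmul, ← exp_nsmul, ← exp_add]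
    congr 1
    have := Int.mul_ediv_add_emod (-m) n
    simp only [nsmul_eq_mul, Int.toNat_of_nonneg hmod]
    linarith

end LaurentSeries

end Laurent

section GenericMatrices

open FirstOrder.Language

namespace FirstOrder.Language.Substructure.IsElementary

variable {L : Type*} [Field L] {Γ : Type*} [LinearOrderedCommGroupWithZero Γ]

/-- Existential formulas with parameters in an elementary substructure have witnesses there. -/
lemma exists_mem_realize {L : FirstOrder.Language} {M : Type*} [L.Structure M]
    {S : L.Substructure M} (hS : S.IsElementary) {α : Type*} (φ : L.Formula (α ⊕ Unit))
    (x : α → S) (h : ∃ y : M, φ.Realize (Sum.elim ((↑) ∘ x) fun _ ↦ y)) :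
    ∃ y ∈ S, φ.Realize (Sum.elim ((↑) ∘ x) fun _ ↦ y) := by
  let T : L.ElementarySubstructure M := ⟨S, hS⟩
  obtain ⟨y, hy⟩ := h
  have h1 : (φ.iExs Unit).Realize (T.subtype ∘ x) := Formula.realize_iExs.2 ⟨_, hy⟩
  rw [T.subtype.map_formula] at h1
  obtain ⟨z, hz⟩ := Formula.realize_iExs.1 h1
  refine ⟨z (), (z ()).2, ?_⟩
  rw [← T.subtype.map_formula, Sum.comp_elim] at hz
  exact hz

variable {v : Valuation L Γ} {γ : Γ}

/-- An elementary substructure of a valued field as a subfield. -/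
def subfield {S : letI : LVR.Structure L := valuedStructure v γ; LVR.Substructure L}
    (hS : letI : LVR.Structure L := valuedStructure v γ; S.IsElementary) : Subfield L where
  carrier := {x | letI : LVR.Structure L := valuedStructure v γ; x ∈ S}
  zero_mem' := letI : LVR.Structure L := valuedStructure v γ
    S.fun_mem LVRFunc.zero ![] nofun
  one_mem' := letI : LVR.Structure L := valuedStructure v γ
    S.fun_mem LVRFunc.one ![] nofun
  add_mem' {a b} ha hb := letI : LVR.Structure L := valuedStructure v γ
    S.fun_mem LVRFunc.add ![a, b] (Fin.forall_fin_two.2 ⟨ha, hb⟩)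
  mul_mem' {a b} ha hb := letI : LVR.Structure L := valuedStructure v γ
    S.fun_mem LVRFunc.mul ![a, b] (Fin.forall_fin_two.2 ⟨ha, hb⟩)
  neg_mem' {a} ha := by
    let _ : LVR.Structure L := valuedStructure v γ
    obtain ⟨y, hy, h⟩ := hS.exists_mem_realize
      (Term.equal (LVR.addTerm (.var (.inl ())) (.var (.inr ()))) LVR.zeroTerm)
      (fun _ : Unit ↦ ⟨a, ha⟩) ⟨-a, Formula.realize_equal.2 (add_neg_cancel a)⟩
    exact neg_eq_of_add_eq_zero_right (Formula.realize_equal.1 h) ▸ hy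
  inv_mem' a ha := by
    let _ : LVR.Structure L := valuedStructure v γ
    rcases eq_or_ne a 0 with rfl | h0
    · rwa [inv_zero]
    obtain ⟨y, hy, h⟩ := hS.exists_mem_realize
      (Term.equal (LVR.mulTerm (.var (.inl ())) (.var (.inr ()))) LVR.oneTerm)
      (fun _ : Unit ↦ ⟨a, ha⟩) ⟨a⁻¹, Formula.realize_equal.2 (mul_inv_cancel₀ h0)⟩
    exact inv_eq_of_mul_eq_one_right (Formula.realize_equal.1 h) ▸ hy

lemma exists_mem_val_eq {S : letI : LVR.Structure L := valuedStructure v γ; LVR.Substructure L}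
    (hS : letI : LVR.Structure L := valuedStructure v γ; S.IsElementary) {x : L} (hx : v x = γ) :
    ∃ y ∈ subfield hS, v y = γ := by
  let _ : LVR.Structure L := valuedStructure v γ
  obtain ⟨y, hy, h⟩ := hS.exists_mem_realize
    (Relations.formula₁ (L := LVR) LVRRel.N (.var (.inr ()))) (Empty.elim : Empty → S)
    ⟨x, Formula.realize_rel₁.2 hx⟩
  exact ⟨y, hy, Formula.realize_rel₁.1 h⟩

end FirstOrder.Language.Substructure.IsElementary

/-- Equivalent valuations define the same `L_VR`-structure. -/
lemma Valuation.IsEquiv.valuedStructure_eq {L Γ Δ : Type*} [Field L]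
    [LinearOrderedCommGroupWithZero Γ] [LinearOrderedCommGroupWithZero Δ]
    {v : Valuation L Γ} {w : Valuation L Δ} (h : v.IsEquiv w) (π : L) :
    valuedStructure v (v π) = valuedStructure w (w π) := by
  refine Language.Structure.ext rfl ?_
  ext n r x
  cases r with
  | dvd => exact h _ _
  | N => exact h.eq_iff
  | pow n => exact Iff.rfl

open MvPolynomial

variable {L Γ σ : Type*} [Field L] [LinearOrderedCommGroupWithZero Γ] {v : Valuation L Γ}

/-- Two tuples of integers at which all primitive polynomials over a subfield take unit values
correspond under a partial isomorphism fixing the subfield. -/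
lemma PartialIso.of_val_eval₂_eq_one {π : L} {K : Subfield L} (hπ : π ∈ K) {g h : σ → L}
    (hg : ∀ p : MvPolynomial σ K, (∀ m, v ((p.coeff m : K) : L) ≤ 1) →
      (∃ m, v ((p.coeff m : K) : L) = 1) → v (p.eval₂ K.subtype g) = 1)
    (hh : ∀ p : MvPolynomial σ K, (∀ m, v ((p.coeff m : K) : L) ≤ 1) →
      (∃ m, v ((p.coeff m : K) : L) = 1) → v (p.eval₂ K.subtype h) = 1) :
    PartialIso v π v π (eval₂Hom K.subtype g) (eval₂Hom K.subtype h) := by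
  have key (p : MvPolynomial σ K) : v (p.eval₂ K.subtype g) = v (p.eval₂ K.subtype h) := by
    rcases eq_or_ne p 0 with rfl | hp
    · simp
    obtain ⟨m, hm, hmax⟩ := p.support.exists_max_image (fun m ↦ v ((p.coeff m : K) : L))
      (support_nonempty.2 hp)
    have hc : p.coeff m ≠ 0 := mem_support_iff.1 hm
    have hc' : v ((p.coeff m : K) : L) ≠ 0 := (v.ne_zero_iff).2 (by simpa using hc)
    have hle (k : σ →₀ ℕ) : v (((C (p.coeff m)⁻¹ * p).coeff k : K) : L) ≤ 1 := by
      rw [coeff_C_mul, Subfield.coe_mul, Subfield.coe_inv, map_mul, map_inv₀, mul_comm,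
        ← div_eq_mul_inv, div_le_one₀ (zero_lt_iff.2 hc')]
      by_cases hk : k ∈ p.support
      · exact hmax k hk
      · simp [notMem_support_iff.1 hk]
    have hone : v (((C (p.coeff m)⁻¹ * p).coeff m : K) : L) = 1 := by
      rw [coeff_C_mul, inv_mul_cancel₀ hc, Subfield.coe_one, map_one]
    have hval {f : σ → L} (hf : v ((C (p.coeff m)⁻¹ * p).eval₂ K.subtype f) = 1) :
        v (p.eval₂ K.subtype f) = v ((p.coeff m : K) : L) := by
      rw [eval₂_mul, eval₂_C, map_mul, map_inv₀, map_inv₀] at hf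
      exact ((inv_mul_eq_one₀ hc').1 hf).symm
    rw [hval (hg _ hle ⟨m, hone⟩), hval (hh _ hle ⟨m, hone⟩)]
  refine ⟨fun a b ↦ ?_, fun a n _ ↦ ?_, C ⟨π, hπ⟩, by simp, by simp⟩
  · simp only [coe_eval₂Hom, key]
  · simp only [coe_eval₂Hom, key]

lemma Valuation.residue_ne_zero_iff (v : Valuation L Γ) (x : v.valuationSubring) :
    IsLocalRing.residue v.valuationSubring x ≠ 0 ↔ v (x : L) = 1 := by
  rw [IsLocalRing.residue_ne_zero_iff_isUnit]
  exact (Valuation.integer.integers v).isUnit_iff_valuation_eq_one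

/-- A primitive polynomial takes a unit value at a tuple with algebraically independent
residues. -/
lemma Valuation.eval₂_eq_one_of_residue {K : Subfield L} {g : σ → v.valuationSubring}
    (hg : ∀ p : MvPolynomial σ (IsLocalRing.ResidueField v.valuationSubring), p ≠ 0 →
      (∀ m, p.coeff m ∈ {u | ∃ c : v.valuationSubring, (c : L) ∈ K ∧
        IsLocalRing.residue v.valuationSubring c = u}) →
      p.eval (fun s ↦ IsLocalRing.residue v.valuationSubring (g s)) ≠ 0)
    (p : MvPolynomial σ K) (hp : ∀ m, v ((p.coeff m : K) : L) ≤ 1)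
    (hp1 : ∃ m, v ((p.coeff m : K) : L) = 1) :
    v (p.eval₂ K.subtype fun s ↦ (g s : L)) = 1 := by
  obtain ⟨q, hq⟩ : p.map K.subtype ∈ Set.range (MvPolynomial.map v.valuationSubring.subtype) := by
    rw [mem_range_map_iff_coeffs_subset]
    intro c hc
    obtain ⟨m, -, rfl⟩ := mem_coeffs_iff.1 (Finset.mem_coe.1 hc)
    exact ⟨⟨_, hp m⟩, by rw [coeff_map]; rfl⟩
  have hqc (m : σ →₀ ℕ) : ((q.coeff m : v.valuationSubring) : L) = (p.coeff m : K) := by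
    simpa [coeff_map] using congrArg (coeff m) hq
  obtain ⟨m, hm⟩ := hp1
  have h := hg (q.map (IsLocalRing.residue v.valuationSubring))
    (fun h ↦ (v.residue_ne_zero_iff (q.coeff m)).2 (by rw [hqc, hm])
      (by rw [← coeff_map, h, coeff_zero]))
    fun k ↦ ⟨q.coeff k, by rw [hqc]; exact (p.coeff k).2, (coeff_map _ _ _).symm⟩
  rw [← Function.comp_def (IsLocalRing.residue _) g, ← map_eval,
    Valuation.residue_ne_zero_iff] at h
  rw [eval₂_eq_eval_map, ← hq, ← h]
  exact congrArg v (map_eval v.valuationSubring.subtype g q).symm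

lemma Valuation.det_eq_one_of_residue {K : Subfield L} {n : ℕ}
    {g : Matrix (Fin n) (Fin n) v.valuationSubring}
    (hg : ∀ p : MvPolynomial (Fin n × Fin n) (IsLocalRing.ResidueField v.valuationSubring), p ≠ 0 →
      (∀ m, p.coeff m ∈ {u | ∃ c : v.valuationSubring, (c : L) ∈ K ∧
        IsLocalRing.residue v.valuationSubring c = u}) →
      p.eval (fun s ↦ IsLocalRing.residue v.valuationSubring (g s.1 s.2)) ≠ 0) :
    v (g.det : L) = 1 := by
  rw [← Valuation.residue_ne_zero_iff, RingHom.map_det]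
  have hdet : ((Matrix.mvPolynomialX (Fin n) (Fin n) ℤ).det.map
      (Int.castRingHom (IsLocalRing.ResidueField v.valuationSubring))) =
      (Matrix.mvPolynomialX (Fin n) (Fin n) (IsLocalRing.ResidueField v.valuationSubring)).det := by
    rw [RingHom.map_det]
    congr 1
    ext1 i j
    simp [Matrix.mvPolynomialX]
  have h := hg _ (Matrix.det_mvPolynomialX_ne_zero _ _) fun m ↦
    ⟨((Matrix.mvPolynomialX (Fin n) (Fin n) ℤ).det.coeff m : ℤ), by
      simp, by rw [← hdet, coeff_map, map_intCast, eq_intCast]⟩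
  rw [RingHom.map_det] at h
  rw [← Matrix.mvPolynomialX_mapMatrix_eval ((IsLocalRing.residue v.valuationSubring).mapMatrix g)]
  exact h

end GenericMatrices

section EquivalentValuations

variable {F : Type*} {Γ Δ : Type*} [Field F] [LinearOrderedCommGroupWithZero Γ]
  [LinearOrderedCommGroupWithZero Δ] {v : Valuation F Γ} {w : Valuation F Δ} {π : F}

lemma IsLaurentLike.of_isEquiv (hv : IsLaurentLike v π) (h : v.IsEquiv w) :
    IsLaurentLike w π := by
  refine hv.of_transfer w π (fun φ hφ ↦ ?_) hv.unif_ne (h.lt_one_iff_lt_one.1 hv.unif_lt)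
    fun x hx ↦ (h _ _).1 (hv.unif_le x (h.lt_one_iff_lt_one.2 hx))
  rwa [← h.valuedStructure_eq π]

lemma PartialIso.of_isEquiv {A : Type*} [CommRing A] {i j : A →+* F}
    (hij : PartialIso v π v π i j) (h : v.IsEquiv w) : PartialIso w π w π i j := by
  refine ⟨fun a b ↦ ?_, fun a n hn ↦ ?_, hij.unif⟩
  · rw [← h, ← h, hij.le_iff]
  · simpa only [← map_pow, h.eq_iff] using hij.pow_iff a n hn

end EquivalentValuations

/-- Let `L` be a valued field whose value group has a least
positive element, regarded as an `L_VR`-structure, elementarily equivalent to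
`ℂ((t))`, and let `K` be an elementary `L_VR`-substructure of `L` (so `L` is an
elementary extension of `K`), with `k ⊆ k_L` the residue field of `K` (the
image of `O_L ∩ K` under the residue map).  Let `n ≥ 1` and let
`g, h ∈ O_L^{n×n}` be matrices whose reductions have entries algebraically
independent over `k` (no nonzero multivariate polynomial with coefficients in
`k` vanishes on the entries of `res g`, resp. of `res h`).  Then
`g, h ∈ GL(n, O_L)` (their determinants have valuation `0`, i.e. `v(det) = 1`
multiplicatively), and `g` and `h` realize the same complete type over `K`:
every `L_VR`-formula in `n²` free variables with parameters from `K` holds of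
`g` iff it holds of `h`. -/
theorem stmt_19 {L : Type*} [Field L] {Γ₀ : Type*} [LinearOrderedCommGroupWithZero Γ₀]
    (v : Valuation L Γ₀) (hsurj : Function.Surjective v)
    (γ₁ : Γ₀) (hγ₁ : IsLeastPos γ₁) :
    letI : LVR.Structure L := valuedStructure v γ₁
    letI : LVR.Structure (LaurentSeries ℂ) := laurentStructure
    ∀ (_ : L ≅[LVR] LaurentSeries ℂ)
      (S : LVR.Substructure L) (_ : S.IsElementary)
      (n : ℕ) (_ : 1 ≤ n)
      (g h : Matrix (Fin n) (Fin n) v.valuationSubring)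
      (_ : ∀ p : MvPolynomial (Fin n × Fin n)
            (IsLocalRing.ResidueField v.valuationSubring), p ≠ 0 →
        (∀ m, MvPolynomial.coeff m p ∈ {u | ∃ c : v.valuationSubring, (c : L) ∈ S ∧
            IsLocalRing.residue v.valuationSubring c = u}) →
        MvPolynomial.eval
          (fun ij : Fin n × Fin n =>
            IsLocalRing.residue v.valuationSubring (g ij.1 ij.2)) p ≠ 0)
      (_ : ∀ p : MvPolynomial (Fin n × Fin n)
            (IsLocalRing.ResidueField v.valuationSubring), p ≠ 0 →
        (∀ m, MvPolynomial.coeff m p ∈ {u | ∃ c : v.valuationSubring, (c : L) ∈ S ∧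
            IsLocalRing.residue v.valuationSubring c = u}) →
        MvPolynomial.eval
          (fun ij : Fin n × Fin n =>
            IsLocalRing.residue v.valuationSubring (h ij.1 ij.2)) p ≠ 0),
      (v ((g.det : v.valuationSubring) : L) = 1 ∧
       v ((h.det : v.valuationSubring) : L) = 1) ∧
      ∀ (φ : LVR.Formula (ℕ ⊕ (Fin n × Fin n))) (par : ℕ → L) (_ : ∀ i, par i ∈ S),
        φ.Realize (Sum.elim par fun ij : Fin n × Fin n => (g ij.1 ij.2 : L)) ↔
          φ.Realize (Sum.elim par fun ij : Fin n × Fin n => (h ij.1 ij.2 : L)) := by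
  intro hequiv S hS n _ g h hg hh
  let K : Subfield L := hS.subfield
  obtain ⟨x, hx⟩ := hsurj γ₁
  obtain ⟨π, hπ, rfl⟩ := hS.exists_mem_val_eq hx
  have hg' := v.eval₂_eq_one_of_residue (K := K) hg
  have hh' := v.eval₂_eq_one_of_residue (K := K) hh
  refine ⟨⟨Valuation.det_eq_one_of_residue (K := K) hg,
    Valuation.det_eq_one_of_residue (K := K) hh⟩, fun φ par hpar ↦ ?_⟩
  have hL : IsLaurentLike v π := by
    refine (LaurentSeries.isLaurentLike (K := ℂ)).of_transfer v π ?_ (v.ne_zero_iff.1 hγ₁.1) hγ₁.2.1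
      fun x hx ↦ ?_
    · have ht : laurentStructure = valuedStructure Valued.v
          (Valued.v (HahnSeries.single 1 1 : LaurentSeries ℂ)) :=
        congrArg _ (LaurentSeries.valuation_single_zpow ℂ 1).symm
      rw [ht] at hequiv
      exact fun φ ↦ ((@Language.elementarilyEquivalent_iff _ _ _ (_) (_)).1 hequiv φ).2
    · rcases eq_or_ne (v x) 0 with h0 | h0
      · simp [h0]
      · exact hγ₁.2.2 _ h0 hx
  have he := v.isEquiv_valuation_valuationSubring
  have key := ((PartialIso.of_val_eval₂_eq_one hπ hg' hh').of_isEquiv he).realize_iff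
    (hL.of_isEquiv he) (hL.of_isEquiv he) φ
    (Sum.elim (fun i ↦ MvPolynomial.C (⟨par i, hpar i⟩ : K)) MvPolynomial.X)
  have hcomp (f : Fin n × Fin n → L) : MvPolynomial.eval₂Hom K.subtype f ∘
      Sum.elim (fun i ↦ MvPolynomial.C (⟨par i, hpar i⟩ : K)) MvPolynomial.X =
      Sum.elim par f := by
    ext (_ | _) <;> simp
  rwa [hcomp, hcomp, ← he.valuedStructure_eq π] at key
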